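/- arXiv:2506.17586 — 5 statements merged into one kernel-verified Lean document; each statement's English description precedes it below -/
import Mathlib

section
/- Let R be a Noetherian commutative ring and I = (x_1, ..., x_t) an ideal of R generated by t elements. Then for every R-module M and every integer i > t, the local cohomology module H_I^i(M) vanishes. -/
universe u

open RingTheory.Sequence

section

open CategoryTheory Limits

section ExtNull

variable {R : Type u} [CommRing R]

/-- A morphism `f : X ⟶ Y` of modules is null in degree `i` if precomposition with `f` is the
zero map `Ext^i(Y, M) → Ext^i(X, M)` for every module `M`. -/
def ExtNull {X Y : ModuleCat.{u} R} (f : X ⟶ Y) (i : ℕ) : Prop :=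
  ∀ (M : ModuleCat.{u} R) (e : Abelian.Ext.{u} Y M i), (Abelian.Ext.mk₀ f).comp e (zero_add i) = 0

lemma ExtNull.precomp {X Y Z : ModuleCat.{u} R} {f : X ⟶ Y} {i : ℕ} (hf : ExtNull f i)
    (g : Z ⟶ X) : ExtNull (g ≫ f) i := fun M e => by
  rw [← Abelian.Ext.mk₀_comp_mk₀_assoc, hf M e, Abelian.Ext.comp_zero]

lemma ExtNull.postcomp {X Y Z : ModuleCat.{u} R} {f : X ⟶ Y} {i : ℕ} (hf : ExtNull f i)
    (g : Y ⟶ Z) : ExtNull (f ≫ g) i := fun M e => by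
  rw [← Abelian.Ext.mk₀_comp_mk₀_assoc, hf M]

lemma extNull_of_shortExact {S T : ShortComplex (ModuleCat.{u} R)} (hS : S.ShortExact)
    (hT : T.ShortExact) (φ : S ⟶ T) {Z : ModuleCat.{u} R} (h : T.X₃ ⟶ Z) {j i : ℕ} (hij : 1 + j = i)
    (h₁ : ExtNull φ.τ₁ j) (h₂ : ExtNull (T.g ≫ h) i) : ExtNull (φ.τ₃ ≫ h) i := fun M e => by
  obtain ⟨η, hη⟩ := Abelian.Ext.contravariant_sequence_exact₃ hT M
    ((Abelian.Ext.mk₀ h).comp e (zero_add i))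
    (by rw [Abelian.Ext.mk₀_comp_mk₀_assoc, h₂ M e]) hij
  rw [← Abelian.Ext.mk₀_comp_mk₀_assoc, ← hη,
    ← Abelian.Ext.comp_assoc (a₁₂ := 1) _ _ _ (by lia) (by lia) (by lia),
    ← ShortComplex.ShortExact.extClass_naturality hS hT φ,
    Abelian.Ext.comp_assoc (a₂₃ := j) _ _ _ (by lia) (by lia) (by lia),
    h₁ M η, Abelian.Ext.comp_zero]

lemma homologyMap_eq_zero_of_iCycles_comp_pOpcycles {D : Type*} [Category* D] [Abelian D]
    {ι : Type*} {c : ComplexShape ι} {K L : HomologicalComplex D c} (ψ : K ⟶ L) (n : ι)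
    (h : K.iCycles n ≫ ψ.f n ≫ L.pOpcycles n = 0) :
    HomologicalComplex.homologyMap ψ n = 0 := by
  rw [← cancel_epi (K.homologyπ n), ← cancel_mono (L.homologyι n)]
  simpa using h

lemma isZero_colimit_of_forall_exists_map_eq_zero {K D : Type*} [Category* K] [Category* D]
    [HasZeroMorphisms D] (F : K ⥤ D) [HasColimit F]
    (h : ∀ k, ∃ (l : K) (g : k ⟶ l), F.map g = 0) : IsZero (colimit F) := by
  rw [IsZero.iff_id_eq_zero]
  refine colimit.hom_ext fun k => ?_
  obtain ⟨l, g, hg⟩ := h k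
  rw [← colimit.w F g, hg, zero_comp, zero_comp, zero_comp]

/-- Comparison of the Yoneda-style `Abelian.Ext` with the functor `Ext R C` defined by left deriving
`linearYoneda`. -/
lemma ExtNull.ext_map_eq_zero {X Y : ModuleCat.{u} R} {f : X ⟶ Y} {p : ℕ}
    (hf : ExtNull f (p + 1)) : (Ext R (ModuleCat.{u} R) (p + 1)).map f.op = 0 := by
  ext1; ext1 M
  let P := projectiveResolution X
  let Q := projectiveResolution Y
  let φ : ProjectiveResolution.Hom P Q f := ⟨ProjectiveResolution.lift f P Q, ProjectiveResolution.lift_commutes_zero f P Q⟩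
  let F := ((linearYoneda R (ModuleCat.{u} R)).obj M).rightOp
  suffices h : (F.leftDerived (p + 1)).map f = 0 by
    exact congrArg Quiver.Hom.unop h
  rw [Functor.leftDerived_map_eq F (p + 1) f (ProjectiveResolution.lift f P Q) (by simp)]
  suffices h : (F.mapHomologicalComplex _ ⋙ HomologicalComplex.homologyFunctor _ _ (p + 1)).map
      (ProjectiveResolution.lift f P Q) = 0 by
    rw [h]; simp
  refine homologyMap_eq_zero_of_iCycles_comp_pOpcycles _ _ ?_
  set K := (F.mapHomologicalComplex (ComplexShape.down ℕ)).obj P.complex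
  set L := (F.mapHomologicalComplex (ComplexShape.down ℕ)).obj Q.complex
  apply Quiver.Hom.unop_inj
  ext y
  let z : Q.complex.X (p + 1) ⟶ M := (L.pOpcycles (p + 1)).unop.hom y
  have hz : Q.complex.d (p + 2) (p + 1) ≫ z = 0 := by
    have := L.d_pOpcycles (p + 2) (p + 1)
    exact LinearMap.congr_fun (congrArg (fun t => t.unop.hom) this) y
  have := hf M (Q.extMk z (p + 2) rfl hz)
  rw [ProjectiveResolution.mk₀_comp_extMk z _ rfl hz φ,
    ProjectiveResolution.extMk_eq_zero_iff _ _ _ _ _ p rfl] at this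
  obtain ⟨g, hg⟩ := this
  have h₂ := K.iCycles_d (p + 1) p
  have h₃ := LinearMap.congr_fun (congrArg (fun t => t.unop.hom) h₂) g
  refine Eq.trans ?_ h₃
  change (K.iCycles (p + 1)).unop.hom (φ.hom.f (p + 1) ≫ z) =
    (K.iCycles (p + 1)).unop.hom (P.complex.d (p + 1) p ≫ g)
  rw [hg]

lemma extNull_of_projective {X Y : ModuleCat.{u} R} (f : X ⟶ Y) {i : ℕ} (hi : 0 < i)
    [Projective X] : ExtNull f i := fun M e => by
  obtain ⟨p, rfl⟩ := Nat.exists_eq_succ_of_ne_zero hi.ne'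
  exact Abelian.Ext.eq_zero_of_projective _

end ExtNull

namespace Ideal

variable {R : Type u} [CommRing R]

/-- The map `R ⧸ J ⟶ R ⧸ K` given by multiplication by `r`, when `r • J ≤ K`. -/
def quotientMulMap (J K : Ideal R) (r : R) (h : ∀ a ∈ J, r * a ∈ K) :
    ModuleCat.of R (R ⧸ J) ⟶ ModuleCat.of R (R ⧸ K) :=
  ModuleCat.ofHom (Submodule.mapQ J K (LinearMap.mulLeft R r) h)

lemma quotientMulMap_comp {J K L : Ideal R} {r s t : R} (h : ∀ a ∈ J, r * a ∈ K)
    (h' : ∀ a ∈ K, s * a ∈ L) (ht : r * s = t) :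
    quotientMulMap J K r h ≫ quotientMulMap K L s h' =
      quotientMulMap J L t fun a ha => by
        rw [← ht, mul_comm r, mul_assoc]; exact h' _ (h a ha) := by
  subst ht
  ext : 1
  refine Submodule.linearMap_qext _ (LinearMap.ext fun a => ?_)
  change Quotient.mk L (s * (r * a)) = Quotient.mk L (r * s * a)
  rw [mul_left_comm, mul_assoc]

/-- The short complex `R ⧸ (J : y) ⟶ R ⧸ J ⟶ R ⧸ (J + (y))`, whose first map is
multiplication by `y`. -/
def colonShortComplex (J : Ideal R) (y : R) : ShortComplex (ModuleCat.{u} R) where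
  X₁ := ModuleCat.of R (R ⧸ Submodule.comap (LinearMap.mulLeft R y) J)
  X₂ := ModuleCat.of R (R ⧸ J)
  X₃ := ModuleCat.of R (R ⧸ (J ⊔ span {y}))
  f := quotientMulMap _ _ y fun _ ha => ha
  g := quotientMulMap _ _ 1 fun a ha => by
    rw [one_mul]; exact mem_sup_left ha
  zero := by
    ext : 1
    refine Submodule.linearMap_qext _ (LinearMap.ext fun a => ?_)
    refine Quotient.eq_zero_iff_mem.2 ?_
    change 1 * (y * a) ∈ _
    rw [one_mul]
    exact mem_sup_right (mul_mem_right _ _ (mem_span_singleton_self y))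

lemma colonShortComplex_shortExact (J : Ideal R) (y : R) :
    (J.colonShortComplex y).ShortExact := by
  have hi : Function.Injective (J.colonShortComplex y).f.hom := by
    rw [← LinearMap.ker_eq_bot, LinearMap.ker_eq_bot']
    intro m hm
    obtain ⟨a, rfl⟩ := Ideal.Quotient.mk_surjective m
    exact Quotient.eq_zero_iff_mem.2 (Quotient.eq_zero_iff_mem (I := J).1 hm : y * a ∈ J)
  have hs : Function.Surjective (J.colonShortComplex y).g.hom := by
    intro m
    obtain ⟨a, rfl⟩ := Ideal.Quotient.mk_surjective m
    exact ⟨Quotient.mk J a, congrArg (Quotient.mk (J ⊔ span {y})) (one_mul a)⟩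
  refine ShortComplex.ShortExact.mk' ?_ ((ModuleCat.mono_iff_injective _).2 hi)
    ((ModuleCat.epi_iff_surjective _).2 hs)
  rw [ShortComplex.moduleCat_exact_iff]
  intro m hm
  obtain ⟨a, rfl⟩ := Ideal.Quotient.mk_surjective m
  have ha : 1 * a ∈ J ⊔ span {y} := Quotient.eq_zero_iff_mem.1 hm
  rw [one_mul] at ha
  obtain ⟨b, hb, c, hc, rfl⟩ := Submodule.mem_sup.1 ha
  obtain ⟨d, rfl⟩ := mem_span_singleton'.1 hc
  refine ⟨Quotient.mk _ d, (Quotient.eq (I := J) (x := y * d)).2 ?_⟩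
  rw [mul_comm, sub_add_cancel_right]
  exact neg_mem hb

/-- The projection `R ⧸ J ^ m ⟶ R ⧸ J ^ n` for `n ≤ m`. -/
abbrev powTransition (J : Ideal R) {n m : ℕ} (h : n ≤ m) :
    ModuleCat.of R (R ⧸ J ^ m) ⟶ ModuleCat.of R (R ⧸ J ^ n) :=
  quotientMulMap _ _ 1 fun a ha => by rw [one_mul]; exact pow_le_pow_right h ha

lemma exists_forall_pow_mul_mem [IsNoetherianRing R] (J : Ideal R) (x : R) :
    ∃ k₀ : ℕ, ∀ k a, x ^ k * a ∈ J → x ^ k₀ * a ∈ J := by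
  let f : ℕ →o Ideal R :=
    { toFun k := Submodule.comap (LinearMap.mulLeft R (x ^ k)) J
      monotone' := fun k l hkl a (ha : x ^ k * a ∈ J) => by
        change x ^ l * a ∈ J
        rw [← Nat.sub_add_cancel hkl, pow_add, mul_assoc]
        exact mul_mem_left _ _ ha }
  obtain ⟨k₀, hk₀⟩ := monotone_stabilizes_iff_noetherian.2 ‹IsNoetherianRing R› f
  refine ⟨k₀, fun k a ha => ?_⟩
  have : a ∈ f k := ha
  have : a ∈ f (max k₀ k) := f.monotone (le_max_right _ _) this
  rwa [← hk₀ _ (le_max_left _ _)] at this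

/-- The inverse system `R ⧸ J ^ n` has essentially zero `Ext^i`, uniformly in the coefficients. -/
def PowExtNull (J : Ideal R) (i : ℕ) : Prop :=
  ∀ n, ∃ (m : ℕ) (h : n ≤ m), ExtNull (J.powTransition h) i

lemma powExtNull_bot {i : ℕ} (hi : 0 < i) : PowExtNull (⊥ : Ideal R) i := fun n => by
  refine ⟨n + 1, n.le_succ, ?_⟩
  have h : (⊥ : Ideal R) ^ (n + 1) = ⊥ := by rw [← zero_eq_bot, zero_pow n.succ_ne_zero]
  have e : (R ⧸ (⊥ : Ideal R) ^ (n + 1)) ≃ₗ[R] R := Submodule.quotEquivOfEqBot _ h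
  have : Projective (ModuleCat.of R (R ⧸ (⊥ : Ideal R) ^ (n + 1))) := by
    rw [← IsProjective.iff_projective]
    exact Module.Projective.of_equiv e.symm
  exact extNull_of_projective _ hi

/-- Multiplication by `x ^ (m - n)` from `R ⧸ (J ^ m : x ^ m)` to `R ⧸ (J ^ n : x ^ n)` factors, for
large `m`, through a transition map of the system `R ⧸ J ^ n`. -/
lemma PowExtNull.exists_colon [IsNoetherianRing R] {J : Ideal R} {i : ℕ} (hJ : J.PowExtNull i)
    (x : R) (n : ℕ) :
    ∃ (m : ℕ) (_ : n ≤ m) (h : ∀ a ∈ Submodule.comap (LinearMap.mulLeft R (x ^ m)) (J ^ m),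
        x ^ (m - n) * a ∈ Submodule.comap (LinearMap.mulLeft R (x ^ n)) (J ^ n)),
      ExtNull (quotientMulMap _ _ (x ^ (m - n)) h) i := by
  obtain ⟨l, hl, hnull⟩ := hJ n
  obtain ⟨k, hk⟩ := exists_forall_pow_mul_mem (J ^ l) x
  have h₁ : ∀ a ∈ Submodule.comap (LinearMap.mulLeft R (x ^ (l + k))) (J ^ (l + k)), x ^ k * a ∈ J ^ l :=
    fun a ha => hk _ _ (pow_le_pow_right (Nat.le_add_right l k) ha)
  have h₂ : ∀ a ∈ J ^ n, x ^ (l - n) * a ∈ Submodule.comap (LinearMap.mulLeft R (x ^ n)) (J ^ n) :=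
    fun a ha => mul_mem_left _ _ (mul_mem_left _ _ ha)
  have key := (hnull.postcomp (quotientMulMap _ _ (x ^ (l - n)) h₂)).precomp
    (quotientMulMap _ _ (x ^ k) h₁)
  rw [powTransition, quotientMulMap_comp _ _ (one_mul _),
    quotientMulMap_comp _ _ (t := x ^ (l + k - n)) (by rw [← pow_add]; congr 1; lia)] at key
  exact ⟨l + k, by lia, _, key⟩

lemma PowExtNull.exists_sup_span_pow [IsNoetherianRing R] {J : Ideal R} {i : ℕ}
    (h₀ : J.PowExtNull i) (h₁ : J.PowExtNull (i + 1)) (x : R) (n : ℕ) :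
    ∃ (m : ℕ) (_ : n ≤ m) (h : ∀ a ∈ J ^ m ⊔ span {x ^ m}, 1 * a ∈ J ^ n ⊔ span {x ^ n}),
      ExtNull (quotientMulMap _ _ 1 h) (i + 1) := by
  obtain ⟨l, hl, hlnull⟩ := h₁ n
  obtain ⟨m, hm, hle, hmnull⟩ := h₀.exists_colon x l
  have H : ∀ {p q : ℕ}, p ≤ q → ∀ a ∈ J ^ q ⊔ span {x ^ q}, 1 * a ∈ J ^ p ⊔ span {x ^ p} :=
    fun {p q} hpq a ha => by
      rw [one_mul]
      exact sup_le_sup (pow_le_pow_right hpq)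
        (span_singleton_le_span_singleton.2 (pow_dvd_pow x hpq)) ha
  let φ : colonShortComplex (J ^ m) (x ^ m) ⟶ colonShortComplex (J ^ l) (x ^ l) :=
    { τ₁ := quotientMulMap _ _ (x ^ (m - l)) hle
      τ₂ := J.powTransition hm
      τ₃ := quotientMulMap _ _ 1 (H hm)
      comm₁₂ :=
        (quotientMulMap_comp _ _ (by rw [← pow_add]; congr 1; lia)).trans
          (quotientMulMap_comp _ _ (mul_one (x ^ m))).symm
      comm₂₃ := by
        dsimp only [colonShortComplex]
        rw [powTransition, quotientMulMap_comp _ _ (mul_one _),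
          quotientMulMap_comp _ _ (mul_one _)] }
  let q : (colonShortComplex (J ^ l) (x ^ l)).X₃ ⟶ ModuleCat.of R (R ⧸ J ^ n ⊔ span {x ^ n}) :=
    quotientMulMap _ _ 1 (H hl)
  have hq : ExtNull ((colonShortComplex (J ^ l) (x ^ l)).g ≫ q) (i + 1) := by
    have h' : ∀ a ∈ J ^ n, 1 * a ∈ J ^ n ⊔ span {x ^ n} := fun a ha => by
      rw [one_mul]; exact mem_sup_left ha
    have := hlnull.postcomp (quotientMulMap _ _ 1 h')
    rw [powTransition, quotientMulMap_comp _ _ (mul_one _)] at this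
    dsimp only [q, colonShortComplex]
    rwa [quotientMulMap_comp _ _ (mul_one _)]
  have key := extNull_of_shortExact (colonShortComplex_shortExact _ _)
    (colonShortComplex_shortExact _ _) φ q (add_comm 1 i) hmnull hq
  refine ⟨m, hl.trans hm, H (hl.trans hm), ?_⟩
  rw [← quotientMulMap_comp (H hm) (H hl) (mul_one _)]
  exact key

lemma PowExtNull.sup_span [IsNoetherianRing R] {J : Ideal R} {i : ℕ}
    (h₀ : J.PowExtNull i) (h₁ : J.PowExtNull (i + 1)) (x : R) :
    (J ⊔ span {x}).PowExtNull (i + 1) := fun n => by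
  obtain ⟨m, hm, h, hnull⟩ := h₀.exists_sup_span_pow h₁ x n
  have h₂ : ∀ a ∈ (J ⊔ span {x}) ^ (m + m), 1 * a ∈ J ^ m ⊔ span {x ^ m} := fun a ha => by
    rw [one_mul, ← span_singleton_pow]
    exact sup_pow_add_le_pow_sup_pow ha
  have h₃ : ∀ a ∈ J ^ n ⊔ span {x ^ n}, 1 * a ∈ (J ⊔ span {x}) ^ n := fun a ha => by
    rw [one_mul]
    have hle : J ^ n ⊔ span {x ^ n} ≤ (J ⊔ span {x}) ^ n := by
      rw [← span_singleton_pow]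
      exact sup_le (pow_right_mono le_sup_left n) (pow_right_mono le_sup_right n)
    exact hle ha
  have key := (hnull.postcomp (quotientMulMap _ _ 1 h₃)).precomp (quotientMulMap _ _ 1 h₂)
  rw [quotientMulMap_comp _ _ (mul_one _), quotientMulMap_comp _ _ (mul_one _)] at key
  exact ⟨m + m, by lia, key⟩

lemma powExtNull_span_range [IsNoetherianRing R] (t : ℕ) (x : Fin t → R) (i : ℕ) (hi : t < i) :
    (span (Set.range x)).PowExtNull i := by
  induction t generalizing i with
  | zero =>
    rw [Set.range_eq_empty, span_empty]
    exact powExtNull_bot hi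
  | succ t ih =>
    obtain ⟨j, rfl⟩ := Nat.exists_eq_succ_of_ne_zero (Nat.ne_zero_of_lt hi)
    rw [← Fin.cons_self_tail x, Fin.range_cons, span_insert, sup_comm]
    exact (ih (Fin.tail x) j (by lia)).sup_span (ih (Fin.tail x) (j + 1) (by lia)) (x 0)

lemma PowExtNull.isZero_localCohomology {J : Ideal R} {i : ℕ} (hi : i ≠ 0) (hJ : J.PowExtNull i) :
    IsZero (localCohomology J i) := by
  obtain ⟨p, rfl⟩ := Nat.exists_eq_succ_of_ne_zero hi
  have := localCohomology.hasColimitDiagram.{u, 0} (localCohomology.idealPowersDiagram J) (p + 1)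
  refine isZero_colimit_of_forall_exists_map_eq_zero
    (localCohomology.diagram (localCohomology.idealPowersDiagram J) (p + 1)) fun k => ?_
  obtain ⟨m, hm, hnull⟩ := hJ k.unop.unop
  have hg : (localCohomology.ringModIdeals (localCohomology.idealPowersDiagram J)).map
      (homOfLE hm).op = J.powTransition hm := by
    refine ModuleCat.hom_ext (LinearMap.ext fun a => ?_)
    obtain ⟨a, rfl⟩ := Ideal.Quotient.mk_surjective a
    exact congrArg (Quotient.mk (J ^ k.unop.unop)) (one_mul a).symm
  refine ⟨Opposite.op (Opposite.op m), (homOfLE hm).op.op, ?_⟩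
  exact (congrArg (fun f => (Ext R (ModuleCat.{u} R) (p + 1)).map (Quiver.Hom.op f)) hg).trans
    hnull.ext_map_eq_zero

end Ideal

end

/-- If `R` is a Noetherian commutative ring and `I = (x₁, …, x_t)` is an
ideal generated by `t` elements, then for every `R`-module `M` and every `i > t` the local
cohomology module `H_I^i(M)` vanishes. -/
theorem localCohomology_vanishes_of_lt_index
    (R : Type u) [CommRing R] [IsNoetherianRing R]
    (t : ℕ) (x : Fin t → R) (I : Ideal R) (hI : I = Ideal.span (Set.range x))
    (M : ModuleCat.{u} R) (i : ℕ) (hi : t < i) :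
    Subsingleton ((localCohomology I i).obj M) := by
  subst hI
  exact ModuleCat.subsingleton_of_isZero <| CategoryTheory.Functor.map_isZero ((CategoryTheory.evaluation _ _).obj M) <|
    (Ideal.powExtNull_span_range t x i hi).isZero_localCohomology (Nat.ne_zero_of_lt hi)
end

section
/- Let R be a Noetherian ring and I, J ideals of R. Fix an integer i ≥ 1 and assume that Ass H_I^i(R) is finite. If depth_I(R) > i − 1, then Ass H_I^i(J) is finite if and only if Ass H_I^{i−1}(R/J) is finite. -/
universe u

open RingTheory.Sequence

/-- The `I`-depth of an `A`-module `M` (valued in `ℕ∞`): the supremum of the lengths of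
`M`-regular sequences consisting of elements of `I`. -/
noncomputable def depthIn {A : Type u} [CommRing A] (I : Ideal A)
    (M : Type u) [AddCommGroup M] [Module A M] : ℕ∞ :=
  sSup {n : ℕ∞ | ∃ rs : List A, (rs.length : ℕ∞) = n ∧ (∀ r ∈ rs, r ∈ I) ∧ IsRegular M rs}

universe v v' u'

section

open CategoryTheory Limits Opposite

namespace CategoryTheory.Functor

open HomologicalComplex

variable {C : Type u} [Category.{v} C] [Abelian C]
  {D : Type u'} [Category.{v'} D] [Abelian D]
  {F₁ F₂ F₃ : C ⥤ D} [F₁.Additive] [F₂.Additive] [F₃.Additive]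
  (α : F₁ ⟶ F₂) (β : F₂ ⟶ F₃) (w : α ≫ β = 0)

/-- The complex `F₁(K) ⟶ F₂(K) ⟶ F₃(K)` of chain complexes attached to natural transformations
`F₁ ⟶ F₂ ⟶ F₃` whose composition vanishes. -/
noncomputable abbrev mapChainShortComplex (K : ChainComplex C ℕ) :
    ShortComplex (ChainComplex D ℕ) :=
  ShortComplex.mk ((NatTrans.mapHomologicalComplex α _).app K)
    ((NatTrans.mapHomologicalComplex β _).app K) (by
      ext n
      exact NatTrans.congr_app w (K.X n))

/-- A chain map `K ⟶ L` induces a morphism of complexes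
`(F₁(K) ⟶ F₂(K) ⟶ F₃(K)) ⟶ (F₁(L) ⟶ F₂(L) ⟶ F₃(L))`. -/
noncomputable abbrev mapChainShortComplexMap {K L : ChainComplex C ℕ} (φ : K ⟶ L) :
    mapChainShortComplex α β w K ⟶ mapChainShortComplex α β w L where
  τ₁ := (F₁.mapHomologicalComplex _).map φ
  τ₂ := (F₂.mapHomologicalComplex _).map φ
  τ₃ := (F₃.mapHomologicalComplex _).map φ

section

variable {α β w} {K L : ChainComplex C ℕ}

/-- The connecting homomorphism in the homology sequence of
`0 ⟶ F₁(K) ⟶ F₂(K) ⟶ F₃(K) ⟶ 0`. -/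
noncomputable def mapChainδ (hK : (mapChainShortComplex α β w K).ShortExact) (n : ℕ) :
    (homologyFunctor D _ (n + 1)).obj ((F₃.mapHomologicalComplex _).obj K) ⟶
      (homologyFunctor D _ n).obj ((F₁.mapHomologicalComplex _).obj K) :=
  hK.δ (n + 1) n (by simp)

lemma mapChainδ_naturality (hK : (mapChainShortComplex α β w K).ShortExact)
    (hL : (mapChainShortComplex α β w L).ShortExact) (φ : K ⟶ L) (n : ℕ) :
    mapChainδ hK n ≫ (homologyFunctor D _ n).map ((F₁.mapHomologicalComplex _).map φ) =
      (homologyFunctor D _ (n + 1)).map ((F₃.mapHomologicalComplex _).map φ) ≫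
        mapChainδ hL n :=
  HomologySequence.δ_naturality (mapChainShortComplexMap α β w φ) hK hL (n + 1) n (by simp)

lemma mapChainδ_comp (hK : (mapChainShortComplex α β w K).ShortExact) (n : ℕ) :
    mapChainδ hK n ≫ (homologyFunctor D _ n).map ((NatTrans.mapHomologicalComplex α _).app K) =
      0 :=
  hK.δ_comp (n + 1) n (by simp)

lemma comp_mapChainδ (hK : (mapChainShortComplex α β w K).ShortExact) (n : ℕ) :
    (homologyFunctor D _ (n + 1)).map ((NatTrans.mapHomologicalComplex β _).app K) ≫
      mapChainδ hK n = 0 :=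
  hK.comp_δ (n + 1) n (by simp)

end

lemma isZero_obj_of_epi_map_smul {R : Type*} [Semiring R] [CategoryTheory.Linear R C] (F : C ⥤ D)
    (hF : ∀ X Y : C, F.map (0 : X ⟶ Y) = 0)
    {X : C} (r : R) [Epi (F.map (r • 𝟙 X))] {t : ℕ} (ht : r ^ t • 𝟙 X = 0) :
    IsZero (F.obj X) := by
  have key (k : ℕ) : Epi (F.map (r ^ k • 𝟙 X)) := by
    induction k with
    | zero => simp only [pow_zero, one_smul]; infer_instance
    | succ k ih =>
      have : r ^ (k + 1) • 𝟙 X = (r • 𝟙 X) ≫ (r ^ k • 𝟙 X) := by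
        simp [smul_smul, pow_succ]
      rw [this, F.map_comp]
      infer_instance
  have := key t
  rw [ht, hF] at this
  exact IsZero.of_epi_eq_zero (0 : F.obj X ⟶ F.obj X) rfl

variable (h : ∀ P : C, Projective P →
  (ShortComplex.mk (α.app P) (β.app P) (NatTrans.congr_app w P)).ShortExact)

include h in
lemma shortExact_mapChainShortComplex {X : C} (P : ProjectiveResolution X) :
    (mapChainShortComplex α β w P.complex).ShortExact :=
  HomologicalComplex.shortExact_of_degreewise_shortExact _ fun n => h _ (P.projective n)

variable [HasProjectiveResolutions C]

/-- The connecting homomorphism `Lₙ₊₁F₃ ⟶ LₙF₁` of left derived functors attached to natural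
transformations `F₁ ⟶ F₂ ⟶ F₃` that are short exact on projective objects. -/
noncomputable def leftDerivedδ (n : ℕ) : F₃.leftDerived (n + 1) ⟶ F₁.leftDerived n where
  app X := ((projectiveResolution X).isoLeftDerivedObj F₃ (n + 1)).hom ≫
    mapChainδ (shortExact_mapChainShortComplex α β w h (projectiveResolution X)) n ≫
    ((projectiveResolution X).isoLeftDerivedObj F₁ n).inv
  naturality X Y f := by
    have comm := ProjectiveResolution.lift_commutes_zero f (projectiveResolution X)
        (projectiveResolution Y)
    rw [ProjectiveResolution.isoLeftDerivedObj_hom_naturality_assoc _ _ _ _ comm,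
      Category.assoc, Category.assoc,
      ProjectiveResolution.isoLeftDerivedObj_inv_naturality _ _ _ _ comm]
    simp only [comp_map]
    rw [← reassoc_of% (mapChainδ_naturality)]

lemma leftDerivedδ_comp (n : ℕ) :
    leftDerivedδ α β w h n ≫ NatTrans.leftDerived α n = 0 := by
  ext X
  simp only [leftDerivedδ, NatTrans.comp_app,
    ProjectiveResolution.leftDerived_app_eq α (projectiveResolution X), Category.assoc,
    Iso.inv_hom_id_assoc, reassoc_of% (mapChainδ_comp), zero_comp, comp_zero, zero_app]

lemma comp_leftDerivedδ (n : ℕ) :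
    NatTrans.leftDerived β (n + 1) ≫ leftDerivedδ α β w h n = 0 := by
  ext X
  simp only [leftDerivedδ, NatTrans.comp_app,
    ProjectiveResolution.leftDerived_app_eq β (projectiveResolution X), Category.assoc,
    Iso.inv_hom_id_assoc, reassoc_of% (comp_mapChainδ), zero_comp, comp_zero, zero_app]

lemma exact_leftDerivedδ_app (n : ℕ) (X : C) :
    (ShortComplex.mk ((leftDerivedδ α β w h n).app X) ((NatTrans.leftDerived α n).app X)
      (NatTrans.congr_app (leftDerivedδ_comp α β w h n) X)).Exact := by
  let P := projectiveResolution X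
  have hP := shortExact_mapChainShortComplex α β w h P
  have e : ShortComplex.mk _ _ (mapChainδ_comp hP n) ≅
      ShortComplex.mk ((leftDerivedδ α β w h n).app X) ((NatTrans.leftDerived α n).app X)
        (NatTrans.congr_app (leftDerivedδ_comp α β w h n) X) :=
    ShortComplex.isoMk (P.isoLeftDerivedObj F₃ (n + 1)).symm (P.isoLeftDerivedObj F₁ n).symm
      (P.isoLeftDerivedObj F₂ n).symm
      (by simp only [leftDerivedδ, P, Iso.symm_hom, Iso.inv_hom_id_assoc])
      (by simp only [ProjectiveResolution.leftDerived_app_eq α P, Iso.symm_hom,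
        Iso.inv_hom_id_assoc])
  exact ShortComplex.exact_of_iso e (hP.homology_exact₁ (n + 1) n (by simp))

lemma exact_leftDerived_app_leftDerivedδ_app (n : ℕ) (X : C) :
    (ShortComplex.mk ((NatTrans.leftDerived β (n + 1)).app X) ((leftDerivedδ α β w h n).app X)
      (NatTrans.congr_app (comp_leftDerivedδ α β w h n) X)).Exact := by
  let P := projectiveResolution X
  have hP := shortExact_mapChainShortComplex α β w h P
  have e : ShortComplex.mk _ _ (comp_mapChainδ hP n) ≅
      ShortComplex.mk ((NatTrans.leftDerived β (n + 1)).app X)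
        ((leftDerivedδ α β w h n).app X)
        (NatTrans.congr_app (comp_leftDerivedδ α β w h n) X) :=
    ShortComplex.isoMk (P.isoLeftDerivedObj F₂ (n + 1)).symm
      (P.isoLeftDerivedObj F₃ (n + 1)).symm (P.isoLeftDerivedObj F₁ n).symm
      (by simp only [ProjectiveResolution.leftDerived_app_eq β P, Iso.symm_hom,
        Iso.inv_hom_id_assoc])
      (by simp only [leftDerivedδ, P, Iso.symm_hom, Iso.inv_hom_id_assoc])
  exact ShortComplex.exact_of_iso e (hP.homology_exact₃ (n + 1) n (by simp))

include w h in
lemma epi_leftDerived_app_zero (X : C) : Epi ((NatTrans.leftDerived β 0).app X) := by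
  let P := projectiveResolution X
  have hP := shortExact_mapChainShortComplex α β w h P
  have : Epi ((homologyFunctor D _ 0).map
      ((NatTrans.mapHomologicalComplex β (ComplexShape.down ℕ)).app P.complex)) := by
    have := hP.epi_g
    exact epi_homologyMap_of_epi_of_not_rel (mapChainShortComplex α β w P.complex).g 0 (by simp)
  rw [ProjectiveResolution.leftDerived_app_eq β P]
  infer_instance

lemma leftDerived_app_eq_map_smul {R : Type*} [Semiring R] [CategoryTheory.Linear R C]
    (r : R) (γ : F₁ ⟶ F₁)
    (hγ : ∀ X : C, γ.app X = F₁.map (r • 𝟙 X)) (n : ℕ) (X : C) :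
    (NatTrans.leftDerived γ n).app X = (F₁.leftDerived n).map (r • 𝟙 X) := by
  let P := projectiveResolution X
  have hP : (NatTrans.mapHomologicalComplex γ (ComplexShape.down ℕ)).app P.complex =
      (F₁.mapHomologicalComplex _).map (r • 𝟙 P.complex) := by
    ext i
    simp only [hγ, NatTrans.mapHomologicalComplex_app_f, mapHomologicalComplex_map_f]
    rfl
  rw [ProjectiveResolution.leftDerived_app_eq γ P, hP,
    Functor.leftDerived_map_eq F₁ n (r • 𝟙 X) (P := P) (Q := P) (r • 𝟙 P.complex) (by
      ext
      rw [comp_f, comp_f, ChainComplex.single₀_map_f_zero, smul_f_apply, id_f,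
        Linear.smul_comp, Category.id_comp]
      exact (congrArg (r • ·) (Category.comp_id _).symm).trans
        (Linear.comp_smul (Y := X) (P.complex.X 0) X (P.π.f 0) r (𝟙 X)).symm)]
  rfl

lemma leftDerived_map_zero (F : C ⥤ D) [F.Additive] (n : ℕ) (X Y : C) :
    (F.leftDerived n).map (0 : X ⟶ Y) = 0 := by
  rw [Functor.leftDerived_map_eq F n 0 (P := projectiveResolution X)
    (Q := projectiveResolution Y) 0 (by simp)]
  simp only [Functor.map_zero]
  erw [zero_comp, comp_zero]

end CategoryTheory.Functor

namespace CategoryTheory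

lemma ShortComplex.exact_of_forall_exact_app {J : Type u} [Category.{v} J] {C : Type u'}
    [Category.{v'} C] [Abelian C] (S : ShortComplex (J ⥤ C))
    (hS : ∀ j, (S.map ((evaluation J C).obj j)).Exact) : S.Exact := by
  rw [ShortComplex.exact_iff_isZero_homology, IsZero.iff_id_eq_zero]
  ext j
  exact ((((ShortComplex.exact_iff_isZero_homology _).1 (hS j)).of_iso
    (S.mapHomologyIso ((evaluation J C).obj j)).symm)).eq_of_src _ _

section Ext

variable {R : Type*} [Ring R] {C : Type u} [Category.{v} C] [Abelian C] [Linear R C]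

variable (R) in
lemma linearYoneda_map_app_comp_zero (S : ShortComplex C) (P : Cᵒᵖ) :
    ((linearYoneda R C).map S.f).app P ≫ ((linearYoneda R C).map S.g).app P = 0 := by
  ext (x : P.unop ⟶ S.X₁)
  change (x ≫ S.f) ≫ S.g = 0
  rw [Category.assoc, S.zero, comp_zero]

variable (R) in
lemma shortExact_linearYoneda {S : ShortComplex C} (hS : S.ShortExact) (P : C) [Projective P] :
    (ShortComplex.mk _ _ (linearYoneda_map_app_comp_zero R S (op P))).ShortExact := by
  have := hS.mono_f
  have := hS.epi_g
  refine .mk' ?_ ?_ ?_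
  · rw [ShortComplex.moduleCat_exact_iff]
    intro (x : P ⟶ S.X₂) (hx : x ≫ S.g = 0)
    exact ⟨hS.exact.lift x hx, hS.exact.lift_f x hx⟩
  · rw [ModuleCat.mono_iff_injective]
    intro (x : P ⟶ S.X₁) (y : P ⟶ S.X₁) (hxy : x ≫ S.f = y ≫ S.f)
    exact (cancel_mono S.f).1 hxy
  · rw [ModuleCat.epi_iff_surjective]
    intro (x : P ⟶ S.X₃)
    exact ⟨Projective.factorThru x S.g, Projective.factorThru_comp x S.g⟩

variable (R) in
lemma linearYoneda_rightOp_comp_zero (S : ShortComplex C) :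
    NatTrans.rightOp ((linearYoneda R C).map S.g) ≫
      NatTrans.rightOp ((linearYoneda R C).map S.f) = 0 := by
  ext P
  exact Quiver.Hom.unop_inj (linearYoneda_map_app_comp_zero R S (op P))

variable [EnoughProjectives C]

variable (R) in
/-- The connecting homomorphism `Extⁿ(-, S.X₃) ⟶ Extⁿ⁺¹(-, S.X₁)` of a short exact sequence,
natural in the first variable. -/
noncomputable def extδ {S : ShortComplex C} (hS : S.ShortExact) (n : ℕ) :
    (Ext R C n).flip.obj S.X₃ ⟶ (Ext R C (n + 1)).flip.obj S.X₁ :=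
  NatTrans.leftOp (Functor.leftDerivedδ (NatTrans.rightOp ((linearYoneda R C).map S.g))
    (NatTrans.rightOp ((linearYoneda R C).map S.f)) (linearYoneda_rightOp_comp_zero R S)
    (fun P _ => (shortExact_linearYoneda R hS P).op) n)

lemma map_comp_extδ {S : ShortComplex C} (hS : S.ShortExact) (n : ℕ) :
    (Ext R C n).flip.map S.g ≫ extδ R hS n = 0 :=
  congrArg NatTrans.leftOp (Functor.leftDerivedδ_comp _ _ (linearYoneda_rightOp_comp_zero R S)
    (fun P _ => (shortExact_linearYoneda R hS P).op) n)

lemma extδ_comp_map {S : ShortComplex C} (hS : S.ShortExact) (n : ℕ) :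
    extδ R hS n ≫ (Ext R C (n + 1)).flip.map S.f = 0 :=
  congrArg NatTrans.leftOp (Functor.comp_leftDerivedδ _ _ (linearYoneda_rightOp_comp_zero R S)
    (fun P _ => (shortExact_linearYoneda R hS P).op) n)

lemma exact_map_app_extδ_app {S : ShortComplex C} (hS : S.ShortExact) (n : ℕ) (X : Cᵒᵖ) :
    (ShortComplex.mk (((Ext R C n).flip.map S.g).app X) ((extδ R hS n).app X)
      (NatTrans.congr_app (map_comp_extδ hS n) X)).Exact :=
  (Functor.exact_leftDerivedδ_app _ _ (linearYoneda_rightOp_comp_zero R S)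
    (fun P _ => (shortExact_linearYoneda R hS P).op) n X.unop).unop

lemma exact_extδ_app_map_app {S : ShortComplex C} (hS : S.ShortExact) (n : ℕ) (X : Cᵒᵖ) :
    (ShortComplex.mk ((extδ R hS n).app X) (((Ext R C (n + 1)).flip.map S.f).app X)
      (NatTrans.congr_app (extδ_comp_map hS n) X)).Exact :=
  (Functor.exact_leftDerived_app_leftDerivedδ_app _ _ (linearYoneda_rightOp_comp_zero R S)
    (fun P _ => (shortExact_linearYoneda R hS P).op) n X.unop).unop

lemma mono_ext_zero_map {S : ShortComplex C} (hS : S.ShortExact) (X : Cᵒᵖ) :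
    Mono (((Ext R C 0).obj X).map S.f) :=
  have := Functor.epi_leftDerived_app_zero _ _ (linearYoneda_rightOp_comp_zero R S)
    (fun P _ => (shortExact_linearYoneda R hS P).op) X.unop
  unop_mono_of_epi ((NatTrans.leftDerived (NatTrans.rightOp ((linearYoneda R C).map S.f)) 0).app
    X.unop)

end Ext

section

variable {R : Type*} [CommRing R] {C : Type u} [Category.{v} C] [Abelian C] [Linear R C]
  [EnoughProjectives C]

lemma ext_obj_map_smul (r : R) (n : ℕ) (X Y : C) :
    ((Ext R C n).obj (op X)).map (r • 𝟙 Y) = ((Ext R C n).map (r • 𝟙 X).op).app Y :=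
  congrArg Quiver.Hom.unop (Functor.leftDerived_app_eq_map_smul r
    (NatTrans.rightOp ((linearYoneda R C).map (r • 𝟙 Y))) (fun X => by
      refine Quiver.Hom.unop_inj ?_
      ext (x : X ⟶ Y)
      change x ≫ (r • 𝟙 Y) = (r • 𝟙 X) ≫ x
      simp) n X)

lemma isZero_ext_of_mono_map_smul (n : ℕ) (X Y : C) (r : R)
    [Mono (((Ext R C n).obj (op X)).map (r • 𝟙 Y))] {t : ℕ} (ht : r ^ t • 𝟙 X = 0) :
    IsZero (((Ext R C n).obj (op X)).obj Y) := by
  let F := ((linearYoneda R C).obj Y).rightOp.leftDerived n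
  have : Epi (F.map (r • 𝟙 X)) := by
    have h : Mono (((Ext R C n).map (r • 𝟙 X).op).app Y) := by
      rw [← ext_obj_map_smul]
      infer_instance
    exact op_epi_of_mono (((Ext R C n).map (r • 𝟙 X).op).app Y)
  exact (Functor.isZero_obj_of_epi_map_smul F (Functor.leftDerived_map_zero _ n) r ht).unop

end

end CategoryTheory

namespace ModuleCat
variable {R : Type u} [CommRing R]

lemma isZero_ext_of_isWeaklyRegular {n : ℕ} (N M : ModuleCat.{u} R) (rs : List R)
    (hM : IsWeaklyRegular M rs) (hN : ∀ r ∈ rs, ∃ t : ℕ, r ^ t • 𝟙 N = 0) (hn : n < rs.length) :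
    IsZero (((Ext R (ModuleCat R) n).obj (op N)).obj M) := by
  induction rs generalizing M n with
  | nil => simp at hn
  | cons r rs ih =>
    rw [isWeaklyRegular_cons_iff] at hM
    obtain ⟨t, ht⟩ := hN r (by simp)
    have hS := hM.1.smulShortComplex_shortExact
    have : Mono (((Ext R (ModuleCat R) n).obj (op N)).map (r • 𝟙 M)) := by
      cases n with
      | zero => exact mono_ext_zero_map hS (op N)
      | succ n =>
        refine (exact_extδ_app_map_app (R := R) hS n (op N)).mono_g ?_
        exact (ih (M.smulShortComplex r).X₃ hM.2 (fun s hs => hN s (by simp [hs]))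
          (by simpa using hn)).eq_of_src _ _
    exact isZero_ext_of_mono_map_smul n N M r ht

end ModuleCat

namespace localCohomology

variable {R : Type u} [CommRing R] (I : Ideal R)

/-- The local cohomology of `M` is the colimit of `Extⁿ(R/Iᵗ, M)`. -/
noncomputable def objIsoColimit (n : ℕ) (M : ModuleCat.{u} R) :
    (localCohomology I n).obj M ≅
      colim.obj ((ringModIdeals (idealPowersDiagram I)).op ⋙
        (Ext R (ModuleCat.{u} R) n).flip.obj M) :=
  colimitObjIsoColimitCompEvaluation (diagram (idealPowersDiagram I) n) M

lemma pow_smul_id_ringModIdeals {r : R} (hr : r ∈ I) (t : ℕᵒᵖ) :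
    r ^ t.unop • 𝟙 ((ringModIdeals (idealPowersDiagram I)).obj t) = 0 := by
  ext x
  obtain ⟨x, rfl⟩ := Ideal.Quotient.mk_surjective x
  change Ideal.Quotient.mk (I ^ t.unop) (r ^ t.unop * x) = 0
  exact Ideal.Quotient.eq_zero_iff_mem.2 (Ideal.mul_mem_right _ _ (Ideal.pow_mem_pow hr _))

/-- If `I` contains a weakly `S.X₂`-regular sequence of length greater than `n`, then the local
cohomology sequence `0 ⟶ Hⁿ(S.X₃) ⟶ Hⁿ⁺¹(S.X₁) ⟶ Hⁿ⁺¹(S.X₂)` is exact. -/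
lemma exists_exact_of_isWeaklyRegular {S : ShortComplex (ModuleCat.{u} R)} (hS : S.ShortExact)
    {rs : List R} (hrs : ∀ r ∈ rs, r ∈ I) (hreg : IsWeaklyRegular S.X₂ rs) {n : ℕ}
    (hn : n < rs.length) :
    ∃ (f : (localCohomology I n).obj S.X₃ →ₗ[R] (localCohomology I (n + 1)).obj S.X₁)
      (g : (localCohomology I (n + 1)).obj S.X₁ →ₗ[R] (localCohomology I (n + 1)).obj S.X₂),
      Function.Injective f ∧ Function.Exact f g := by
  let G := (ringModIdeals (idealPowersDiagram I)).op
  let T : ShortComplex (ℕᵒᵖᵒᵖ ⥤ ModuleCat.{u} R) :=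
    ShortComplex.mk (Functor.whiskerLeft G (extδ R hS n))
      (Functor.whiskerLeft G ((Ext R (ModuleCat.{u} R) (n + 1)).flip.map S.f)) (by
        rw [← Functor.whiskerLeft_comp, extδ_comp_map]
        rfl)
  have hT : T.Exact := ShortComplex.exact_of_forall_exact_app T fun j =>
    exact_extδ_app_map_app (R := R) hS n (G.obj j)
  have := AB5OfSize_of_univLE.{0, 0, u, u} (ModuleCat.{u} R)
  have hmono : Mono T.f := by
    have (j : ℕᵒᵖᵒᵖ) : Mono (T.f.app j) := by
      refine (exact_map_app_extδ_app (R := R) hS n (G.obj j)).mono_g ?_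
      exact (ModuleCat.isZero_ext_of_isWeaklyRegular _ _ rs hreg
        (fun r hr => ⟨_, pow_smul_id_ringModIdeals I (hrs r hr) j.unop⟩) hn).eq_of_src _ _
    exact NatTrans.mono_of_mono_app _
  have hex := hT.map (colim (J := ℕᵒᵖᵒᵖ) (C := ModuleCat.{u} R))
  have hmono' : Mono (colim.map T.f) := inferInstance
  rw [ModuleCat.mono_iff_injective] at hmono'
  rw [ShortComplex.ShortExact.moduleCat_exact_iff_function_exact] at hex
  let e₃ := (objIsoColimit I n S.X₃).toLinearEquiv
  let e₁ := (objIsoColimit I (n + 1) S.X₁).toLinearEquiv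
  let e₂ := (objIsoColimit I (n + 1) S.X₂).toLinearEquiv
  refine ⟨e₁.symm.toLinearMap ∘ₗ (colim.map T.f).hom ∘ₗ e₃.toLinearMap,
    e₂.symm.toLinearMap ∘ₗ (colim.map T.g).hom ∘ₗ e₁.toLinearMap, ?_, ?_⟩
  · exact e₁.symm.injective.comp (hmono'.comp e₃.injective)
  · exact Function.Exact.of_ladder_linearEquiv_of_exact (e₁ := e₃.symm) (e₂ := e₁.symm)
      (e₃ := e₂.symm) (by ext; simp; rfl) (by ext; simp; rfl) hex

end localCohomology

end

/-- Let `R` be a Noetherian ring and `I`, `J` ideals.  Fix `i ≥ 1` and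
assume `Ass H_I^i(R)` is finite.  If `depth_I(R) > i - 1`, then `Ass H_I^i(J)` is finite
iff `Ass H_I^{i-1}(R/J)` is finite. -/
theorem associatedPrimes_localCohomology_ideal_finite_iff_of_depth_gt
    (R : Type u) [CommRing R] [IsNoetherianRing R] (I J : Ideal R)
    (i : ℕ) (hi : 1 ≤ i)
    (hfin : (associatedPrimes R ((localCohomology I i).obj (ModuleCat.of R R))).Finite)
    (hdepth : ((i - 1 : ℕ) : ℕ∞) < depthIn I R) :
    (associatedPrimes R ((localCohomology I i).obj (ModuleCat.of R ↥J))).Finite ↔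
      (associatedPrimes R ((localCohomology I (i - 1)).obj (ModuleCat.of R (R ⧸ J)))).Finite := by
  obtain ⟨n, rfl⟩ := Nat.exists_eq_add_of_le' hi
  obtain ⟨_, ⟨rs, rfl, hrs, hreg⟩, hn⟩ := lt_sSup_iff.1 hdepth
  have hS : (ModuleCat.shortComplexOfCompEqZero J.subtype J.mkQ
      (LinearMap.exact_subtype_mkQ J).linearMap_comp_eq_zero).ShortExact :=
    { exact := ModuleCat.shortComplex_exact _ (LinearMap.exact_subtype_mkQ J)
      mono_f := (ModuleCat.mono_iff_injective _).2 J.injective_subtype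
      epi_g := (ModuleCat.epi_iff_surjective _).2 J.mkQ_surjective }
  obtain ⟨f, g, hf, hfg⟩ := localCohomology.exists_exact_of_isWeaklyRegular I hS hrs
    hreg.toIsWeaklyRegular (by exact_mod_cast hn)
  exact ⟨fun h => h.subset (associatedPrimes.subset_of_injective hf),
    fun h => (h.union hfin).subset (associatedPrimes.subset_union_of_exact hf hfg)⟩
end

section
/- Let R be a Noetherian ring, J an ideal generated by an R-regular sequence of length at least 2, and I an ideal containing J. Set d = depth_I(R) and suppose that Ass H_I^{d+1}(R) is finite, that depth_I(R/J) = 0, and that R/J is Cohen–Macaulay and locally a domain (i.e. (R/J)_P is a domain for every prime P). Then Ass H_I^{d+1}(J) is finite if and only if Ass H_I^{d}(R/J) is finite. -/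
universe u

open RingTheory.Sequence

/-- A local ring is Cohen–Macaulay if its depth equals its Krull dimension. -/
def IsCohenMacaulayLocal (A : Type u) [CommRing A] [IsLocalRing A] : Prop :=
  (depthIn (IsLocalRing.maximalIdeal A) A : WithBot ℕ∞) = ringKrullDim A

/-- `A` is a Cohen–Macaulay ring: all of its localizations at primes are Cohen–Macaulay
local rings. -/
def IsCohenMacaulayRing (A : Type u) [CommRing A] : Prop :=
  ∀ (P : Ideal A) (hP : P.IsPrime), letI := hP; IsCohenMacaulayLocal (Localization.AtPrime P)

/-- `A` is locally a domain: `A_P` is a domain for every prime `P`. -/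
def IsLocallyDomain (A : Type u) [CommRing A] : Prop :=
  ∀ (P : Ideal A) (hP : P.IsPrime), letI := hP; IsDomain (Localization.AtPrime P)

section Comparison
open CategoryTheory Limits Opposite

namespace ExtComparison
variable {R : Type u} [CommRing R]

/-- The functor `Hom(-, Y)`, valued in the opposite category of modules. -/
noncomputable abbrev homFunctor (Y : ModuleCat.{u} R) : ModuleCat.{u} R ⥤ (ModuleCat.{u} R)ᵒᵖ :=
  ((linearYoneda R (ModuleCat.{u} R)).obj Y).rightOp

/-- The complex, in the opposite category of modules, of morphisms from a projective resolution
to `Y`. -/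
noncomputable abbrev homComplex {X : ModuleCat.{u} R} (P : ProjectiveResolution X)
    (Y : ModuleCat.{u} R) : ChainComplex (ModuleCat.{u} R)ᵒᵖ ℕ :=
  ((homFunctor Y).mapHomologicalComplex _).obj P.complex

/-- The derived functors of `Hom(-, Y)` are computed by a projective resolution. -/
noncomputable def derivedIso {X : ModuleCat.{u} R} (P : ProjectiveResolution X)
    (Y : ModuleCat.{u} R) (n : ℕ) :
    ((homFunctor Y).leftDerived n).obj X ≅ (homComplex P Y).homology n :=
  P.isoLeftDerivedObj (homFunctor Y) n

/-- The class of a cocycle in the derived functor of `Hom(-, Y)`, before reversing arrows. -/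
noncomputable def clsOp {X : ModuleCat.{u} R} (P : ProjectiveResolution X)
    (Y : ModuleCat.{u} R) (n : ℕ) :
    ((homFunctor Y).leftDerived n).obj X ⟶ (homComplex P Y).opcycles n :=
  (derivedIso P Y n).hom ≫ (homComplex P Y).homologyι n

instance {X : ModuleCat.{u} R} (P : ProjectiveResolution X) (Y : ModuleCat.{u} R) (n : ℕ) :
    Mono (clsOp P Y n) := by
  unfold clsOp; infer_instance

/-- The class in the derived functor `Ext` of a cocycle. -/
noncomputable def cls {X : ModuleCat.{u} R} (P : ProjectiveResolution X)
    (Y : ModuleCat.{u} R) (n : ℕ) :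
    ((homComplex P Y).opcycles n).unop ⟶ ((Ext R (ModuleCat.{u} R) n).obj (op X)).obj Y :=
  (clsOp P Y n).unop

/-- The underlying morphism of a cocycle. -/
noncomputable def inc {X : ModuleCat.{u} R} (P : ProjectiveResolution X)
    (Y : ModuleCat.{u} R) (n : ℕ) :
    ((homComplex P Y).opcycles n).unop ⟶ ModuleCat.of R (P.complex.X n ⟶ Y) :=
  ((homComplex P Y).pOpcycles n).unop

variable {X : ModuleCat.{u} R} (P : ProjectiveResolution X) (Y : ModuleCat.{u} R) (n : ℕ)

lemma cls_surjective : Function.Surjective (cls P Y n) :=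
  (ModuleCat.epi_iff_surjective _).1 (unop_epi_of_mono (clsOp P Y n))

lemma inc_injective : Function.Injective (inc P Y n) :=
  (ModuleCat.mono_iff_injective _).1 (unop_mono_of_epi ((homComplex P Y).pOpcycles n))

lemma exists_inc_eq_iff (f : P.complex.X n ⟶ Y) :
    (∃ w, inc P Y n w = f) ↔ P.complex.d (n+1) n ≫ f = 0 := by
  let K := homComplex P Y
  let S := ShortComplex.mk (K.d (n+1) n) (K.pOpcycles n) (K.d_pOpcycles _ _)
  have hS : S.Exact := S.exact_of_g_is_cokernel (K.opcyclesIsCokernel (n+1) n (by simp))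
  have := hS.unop
  rw [ShortComplex.moduleCat_exact_iff] at this
  constructor
  · rintro ⟨w, rfl⟩
    exact ConcreteCategory.congr_hom S.unop.zero w
  · intro h
    exact this f h

lemma cls_eq_zero_iff (w) : cls P Y (n + 1) w = 0 ↔
    ∃ g : P.complex.X n ⟶ Y, P.complex.d (n+1) n ≫ g = inc P Y (n + 1) w := by
  let K := homComplex P Y
  let S := ShortComplex.mk (clsOp P Y (n+1)) (K.fromOpcycles (n+1) n) (by simp [clsOp, K])
  let S' := ShortComplex.mk (K.homologyι (n+1)) (K.fromOpcycles (n+1) n) (by simp)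
  have hS' : S'.Exact := S'.exact_of_f_is_kernel (K.homologyIsKernel (n+1) n (by simp))
  have hS : S.Exact := (ShortComplex.exact_iff_of_iso
    (ShortComplex.isoMk (derivedIso P Y (n+1)) (Iso.refl _) (Iso.refl _) (by simp [S, S', clsOp, K])
      (by simp [S, S']) : S ≅ S')).2 hS'
  have := hS.unop
  rw [ShortComplex.moduleCat_exact_iff] at this
  have h3 : ∀ g : P.complex.X n ⟶ Y,
      inc P Y (n+1) ((K.fromOpcycles (n+1) n).unop g) = P.complex.d (n+1) n ≫ g :=
    fun g => ConcreteCategory.congr_hom (congrArg Quiver.Hom.unop (K.p_fromOpcycles (n+1) n)) g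
  constructor
  · intro h
    obtain ⟨g, hg⟩ := this w h
    exact ⟨g, (h3 g).symm.trans (congrArg _ hg)⟩
  · rintro ⟨g, hg⟩
    have := inc_injective P Y (n+1) ((h3 g).trans hg)
    rw [← this]
    exact ConcreteCategory.congr_hom S.unop.zero g

variable {Y} in
lemma cls_naturality_right {Y' : ModuleCat.{u} R} (g : Y ⟶ Y') (w) :
    ∃ w', inc P Y' n w' = inc P Y n w ≫ g ∧
      cls P Y' n w' = ((Ext R (ModuleCat.{u} R) n).obj (op X)).map g (cls P Y n w) := by
  let α := NatTrans.rightOp ((linearYoneda R (ModuleCat.{u} R)).map g)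
  let φ : homComplex P Y' ⟶ homComplex P Y :=
    (NatTrans.mapHomologicalComplex α (ComplexShape.down ℕ)).app P.complex
  refine ⟨(HomologicalComplex.opcyclesMap φ n).unop w, ?_, ?_⟩
  · have := congrArg Quiver.Hom.unop (HomologicalComplex.p_opcyclesMap φ n)
    exact ConcreteCategory.congr_hom this w
  · have h : (NatTrans.leftDerived α n).app X = (derivedIso P Y' n).hom ≫
        HomologicalComplex.homologyMap φ n ≫ (derivedIso P Y n).inv := P.leftDerived_app_eq α n
    have h2 : (NatTrans.leftDerived α n).app X ≫ clsOp P Y n =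
      clsOp P Y' n ≫ HomologicalComplex.opcyclesMap φ n := by
      rw [h]
      simp [clsOp]
    have := congrArg Quiver.Hom.unop h2
    exact (ConcreteCategory.congr_hom this w).symm

variable {P} in
lemma cls_naturality_left {X' : ModuleCat.{u} R} {P' : ProjectiveResolution X'} {g : X' ⟶ X}
    (φ : ProjectiveResolution.Hom P' P g) (w) :
    ∃ w', inc P' Y n w' = φ.hom.f n ≫ inc P Y n w ∧
      cls P' Y n w' = ((Ext R (ModuleCat.{u} R) n).map g.op).app Y (cls P Y n w) := by
  let ψ : homComplex P' Y ⟶ homComplex P Y :=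
    ((homFunctor Y).mapHomologicalComplex (ComplexShape.down ℕ)).map φ.hom
  refine ⟨(HomologicalComplex.opcyclesMap ψ n).unop w, ?_, ?_⟩
  · have := congrArg Quiver.Hom.unop (HomologicalComplex.p_opcyclesMap ψ n)
    exact ConcreteCategory.congr_hom this w
  · have h : ((homFunctor Y).leftDerived n).map g ≫ (derivedIso P Y n).hom =
        (derivedIso P' Y n).hom ≫ HomologicalComplex.homologyMap ψ n :=
      ProjectiveResolution.isoLeftDerivedObj_hom_naturality g P' P φ.hom
        (by simpa using φ.hom_f_zero_comp_π_f_zero) (homFunctor Y) n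
    have h2 : ((homFunctor Y).leftDerived n).map g ≫ clsOp P Y n =
        clsOp P' Y n ≫ HomologicalComplex.opcyclesMap ψ n := by
      rw [clsOp, reassoc_of% h]
      simp [clsOp]
    have := congrArg Quiver.Hom.unop h2
    exact (ConcreteCategory.congr_hom this w).symm

open Abelian

lemma d_comp_inc (w) : P.complex.d (n + 1) n ≫ inc P Y n w = 0 :=
  (exists_inc_eq_iff P Y n _).1 ⟨w, rfl⟩

/-- The class of a cocycle in the Yoneda `Ext` group. -/
noncomputable def yonedaCls :
    ((homComplex P Y).opcycles n).unop →ₗ[R] Abelian.Ext.{u} X Y n where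
  toFun w := P.extMk (inc P Y n w) (n + 1) rfl (d_comp_inc P Y n w)
  map_add' v w := by
    rw [P.add_extMk]
    congr 1
    exact map_add (inc P Y n).hom v w
  map_smul' r w := by
    rw [RingHom.id_apply, Ext.smul_eq_comp_mk₀, P.extMk_comp_mk₀]
    congr 1
    refine (map_smul (inc P Y n).hom r w).trans ?_
    exact ((Linear.comp_smul _ _ _ _ _ _).trans (by rw [Category.comp_id])).symm

lemma yonedaCls_surjective : Function.Surjective (yonedaCls P Y n) := by
  intro α
  obtain ⟨f, hf, rfl⟩ := P.extMk_surjective α (n + 1) rfl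
  obtain ⟨w, rfl⟩ := (exists_inc_eq_iff P Y n f).2 hf
  exact ⟨w, rfl⟩

lemma ker_cls_eq : LinearMap.ker (cls P Y (n + 1)).hom = LinearMap.ker (yonedaCls P Y (n + 1)) := by
  ext w
  rw [LinearMap.mem_ker, LinearMap.mem_ker]
  exact (cls_eq_zero_iff P Y n w).trans
    (P.extMk_eq_zero_iff _ _ rfl (d_comp_inc _ _ _ w) n rfl).symm

/-- The comparison between `Ext` as a derived functor and as Yoneda `Ext`, in positive degrees. -/
noncomputable def extEquiv (X Y : ModuleCat.{u} R) (n : ℕ) :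
    ((Ext R (ModuleCat.{u} R) (n + 1)).obj (op X)).obj Y ≃ₗ[R] Abelian.Ext.{u} X Y (n + 1) :=
  let P := projectiveResolution X
  ((cls P Y (n + 1)).hom.quotKerEquivOfSurjective (cls_surjective P Y (n + 1))).symm ≪≫ₗ
    Submodule.quotEquivOfEq _ _ (ker_cls_eq P Y n) ≪≫ₗ
    (yonedaCls P Y (n + 1)).quotKerEquivOfSurjective (yonedaCls_surjective P Y (n + 1))

lemma extEquiv_cls (w) : extEquiv X Y n (cls (projectiveResolution X) Y (n + 1) w) =
    (projectiveResolution X).extMk (inc _ Y (n + 1) w) (n + 2) rfl (d_comp_inc _ Y _ w) := by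
  dsimp only [extEquiv]
  have : ((cls (projectiveResolution X) Y (n + 1)).hom.quotKerEquivOfSurjective
      (cls_surjective (projectiveResolution X) Y (n + 1))).symm
        (cls (projectiveResolution X) Y (n + 1) w) = Submodule.Quotient.mk w := by
    rw [LinearEquiv.symm_apply_eq]
    rfl
  rw [LinearEquiv.trans_apply, LinearEquiv.trans_apply, this]
  rfl

lemma extEquiv_map {X Y Y' : ModuleCat.{u} R} (g : Y ⟶ Y') (n : ℕ) (z) :
    extEquiv X Y' n (((Ext R (ModuleCat.{u} R) (n + 1)).obj (op X)).map g z) =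
      (extEquiv X Y n z).comp (Ext.mk₀ g) (add_zero _) := by
  obtain ⟨w, rfl⟩ := cls_surjective (projectiveResolution X) Y (n + 1) z
  obtain ⟨w', h, h'⟩ := cls_naturality_right (projectiveResolution X) (n + 1) g w
  rw [← h', extEquiv_cls, extEquiv_cls, ProjectiveResolution.extMk_comp_mk₀]
  congr 1

lemma extEquiv_app {X X' Y : ModuleCat.{u} R} (g : X' ⟶ X) (n : ℕ) (z) :
    extEquiv X' Y n (((Ext R (ModuleCat.{u} R) (n + 1)).map g.op).app Y z) =
      (Ext.mk₀ g).comp (extEquiv X Y n z) (zero_add _) := by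
  obtain ⟨w, rfl⟩ := cls_surjective (projectiveResolution X) Y (n + 1) z
  let φ : ProjectiveResolution.Hom (projectiveResolution X') (projectiveResolution X) g :=
    ⟨ProjectiveResolution.lift g _ _, by
      simpa using ProjectiveResolution.lift_commutes_zero g _ _⟩
  obtain ⟨w', h, h'⟩ := cls_naturality_left Y (n + 1) φ w
  rw [← h', extEquiv_cls, extEquiv_cls, ProjectiveResolution.mk₀_comp_extMk _ _ _ _ φ]
  congr 1

end ExtComparison

end Comparison

section LocalCohomology
open CategoryTheory Limits Opposite Abelian

namespace localCohomology
variable {R : Type u} [CommRing R]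

/-- The quotient of `R` by a power of `I`. -/
abbrev quotPow (I : Ideal R) (t : ℕ) : ModuleCat.{u} R := ModuleCat.of R (R ⧸ I ^ t)

/-- The canonical projection between quotients by powers of `I`. -/
def proj (I : Ideal R) {t t' : ℕ} (h : t ≤ t') : quotPow I t' ⟶ quotPow I t :=
  (ringModIdeals (idealPowersDiagram I)).map (homOfLE h).op

/-- The value at `M` of the colimit cocone defining local cohomology. -/
noncomputable def evalCocone (I : Ideal R) (i : ℕ) (M : ModuleCat.{u} R) :
    Cocone (diagram.{u, 0} (idealPowersDiagram I) i ⋙ (evaluation _ _).obj M) :=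
  ((evaluation _ _).obj M).mapCocone (colimit.cocone (diagram.{u, 0} (idealPowersDiagram I) i))

/-- Local cohomology of `M` is a colimit of `Ext` modules. -/
noncomputable def evalCoconeIsColimit (I : Ideal R) (i : ℕ) (M : ModuleCat.{u} R) :
    IsColimit (evalCocone I i M) :=
  isColimitOfPreserves ((evaluation _ _).obj M) (colimit.isColimit _)

instance (I : Ideal R) (i : ℕ) (M : ModuleCat.{u} R) :
    PreservesColimit (diagram.{u, 0} (idealPowersDiagram I) i ⋙ (evaluation _ _).obj M)
      (forget (ModuleCat.{u} R)) :=
  have : PreservesFilteredColimitsOfSize.{0, 0} (forget (ModuleCat.{u} R)) :=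
    preservesFilteredColimitsOfSize_shrink.{0, u, 0, u} _
  inferInstance

/-- The canonical map from the derived functor `Ext` to local cohomology. -/
noncomputable def preι (I : Ideal R) (i : ℕ) (M : ModuleCat.{u} R) (t : ℕ) :
    ((Ext R (ModuleCat.{u} R) i).obj (op (quotPow I t))).obj M ⟶ (localCohomology I i).obj M :=
  (evalCocone I i M).ι.app (op (op t))

lemma preι_app (I : Ideal R) (i : ℕ) (M : ModuleCat.{u} R) {t t' : ℕ} (h : t ≤ t') :
    ((Ext R (ModuleCat.{u} R) i).map (proj I h).op).app M ≫ preι I i M t' = preι I i M t :=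
  (evalCocone I i M).w (homOfLE h).op.op

lemma preι_map (I : Ideal R) (i : ℕ) {M N : ModuleCat.{u} R} (g : M ⟶ N) (t : ℕ) :
    preι I i M t ≫ (localCohomology I i).map g =
      ((Ext R (ModuleCat.{u} R) i).obj (op (quotPow I t))).map g ≫ preι I i N t :=
  ((colimit.ι (diagram.{u, 0} (idealPowersDiagram I) i) (op (op t))).naturality g).symm

lemma preι_eq_zero (I : Ideal R) (i : ℕ) (M : ModuleCat.{u} R) {t : ℕ}
    (y : ((Ext R (ModuleCat.{u} R) i).obj (op (quotPow I t))).obj M) (hy : preι I i M t y = 0) :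
    ∃ (t' : ℕ) (h : t ≤ t'),
      ((Ext R (ModuleCat.{u} R) i).map (proj I h).op).app M y = 0 := by
  let F := diagram.{u, 0} (idealPowersDiagram I) i ⋙ (evaluation _ _).obj M
  obtain ⟨⟨⟨t'⟩⟩, f, g, hfg⟩ := Concrete.isColimit_exists_of_rep_eq F
    (evalCoconeIsColimit I i M) (i := op (op t)) (j := op (op t)) (x := y)
    (y := (0 : ToType (F.obj (op (op t))))) (hy.trans (map_zero (preι I i M t).hom).symm)
  exact ⟨t', leOfHom f.unop.unop, hfg.trans (map_zero (F.map g).hom)⟩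

/-- The canonical map from Yoneda `Ext` to local cohomology. -/
noncomputable def ι (I : Ideal R) (k : ℕ) (M : ModuleCat.{u} R) (t : ℕ) :
    Abelian.Ext.{u} (quotPow I t) M (k + 1) →ₗ[R] (localCohomology I (k + 1)).obj M :=
  (preι I (k + 1) M t).hom ∘ₗ (ExtComparison.extEquiv (quotPow I t) M k).symm.toLinearMap

lemma ι_extEquiv (I : Ideal R) (k : ℕ) (M : ModuleCat.{u} R) (t : ℕ) (y) :
    ι I k M t (ExtComparison.extEquiv (quotPow I t) M k y) = preι I (k + 1) M t y :=
  congrArg (preι I (k + 1) M t).hom (LinearEquiv.symm_apply_apply _ _)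

lemma exists_ι_eq (I : Ideal R) (k : ℕ) (M : ModuleCat.{u} R)
    (z : (localCohomology I (k + 1)).obj M) : ∃ t x, ι I k M t x = z := by
  obtain ⟨⟨⟨t⟩⟩, y, hy⟩ := Concrete.isColimit_exists_rep _ (evalCoconeIsColimit I (k + 1) M) z
  exact ⟨t, ExtComparison.extEquiv (quotPow I t) M k y, (ι_extEquiv I k M t y).trans hy⟩

lemma ι_comp (I : Ideal R) (k : ℕ) (M : ModuleCat.{u} R) {t t' : ℕ} (h : t ≤ t') (x) :
    ι I k M t' ((Ext.mk₀ (proj I h)).comp x (zero_add _)) = ι I k M t x := by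
  obtain ⟨y, rfl⟩ := (ExtComparison.extEquiv (quotPow I t) M k).surjective x
  rw [← ExtComparison.extEquiv_app, ι_extEquiv, ι_extEquiv]
  exact ConcreteCategory.congr_hom (preι_app I (k + 1) M h) y

lemma ι_eq_zero_iff (I : Ideal R) (k : ℕ) (M : ModuleCat.{u} R) (t : ℕ) (x) :
    ι I k M t x = 0 ↔
      ∃ (t' : ℕ) (h : t ≤ t'), (Ext.mk₀ (proj I h)).comp x (zero_add _) = 0 := by
  constructor
  · intro hx
    obtain ⟨y, rfl⟩ := (ExtComparison.extEquiv (quotPow I t) M k).surjective x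
    rw [ι_extEquiv] at hx
    obtain ⟨t', h, hy⟩ := preι_eq_zero I (k + 1) M y hx
    exact ⟨t', h, by rw [← ExtComparison.extEquiv_app, hy, map_zero]⟩
  · rintro ⟨t', h, hx⟩
    rw [← ι_comp I k M h, hx, map_zero]

lemma map_ι (I : Ideal R) (k : ℕ) {M N : ModuleCat.{u} R} (g : M ⟶ N) (t : ℕ) (x) :
    (localCohomology I (k + 1)).map g (ι I k M t x) =
      ι I k N t (x.comp (Ext.mk₀ g) (add_zero _)) := by
  obtain ⟨y, rfl⟩ := (ExtComparison.extEquiv (quotPow I t) M k).surjective x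
  rw [← ExtComparison.extEquiv_map, ι_extEquiv, ι_extEquiv]
  exact ConcreteCategory.congr_hom (preι_map I (k + 1) g t) y

lemma exists_linearMap_of_compatible (I : Ideal R) (k : ℕ)
    (M : ModuleCat.{u} R) (N : ModuleCat.{u} R)
    (f : ∀ t, Abelian.Ext.{u} (quotPow I t) M (k + 1) →ₗ[R] N)
    (hf : ∀ (t t' : ℕ) (h : t ≤ t') (x),
      f t' ((Ext.mk₀ (proj I h)).comp x (zero_add _)) = f t x) :
    ∃ g : (localCohomology I (k + 1)).obj M →ₗ[R] N, ∀ t x, g (ι I k M t x) = f t x := by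
  let c : Cocone (diagram.{u, 0} (idealPowersDiagram I) (k + 1) ⋙ (evaluation _ _).obj M) :=
    { pt := N
      ι :=
        { app := fun t => ModuleCat.ofHom (X :=
              ((_root_.Ext R (ModuleCat.{u} R) (k + 1)).obj (op (quotPow I t.unop.unop))).obj M)
            (f t.unop.unop ∘ₗ
              (ExtComparison.extEquiv (quotPow I t.unop.unop) M k).toLinearMap)
          naturality := by
            rintro ⟨⟨t⟩⟩ ⟨⟨t'⟩⟩ g
            have h : t ≤ t' := leOfHom g.unop.unop
            ext y
            refine (congrArg (f t') (ExtComparison.extEquiv_app (proj I h) k y)).trans ?_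
            exact hf t t' h _ } }
  refine ⟨((evalCoconeIsColimit I (k + 1) M).desc c).hom, fun t x => ?_⟩
  have := ConcreteCategory.congr_hom ((evalCoconeIsColimit I (k + 1) M).fac c (op (op t)))
    ((ExtComparison.extEquiv (quotPow I t) M k).symm x)
  refine Eq.trans this ?_
  exact congrArg (f t) (LinearEquiv.apply_symm_apply _ _)

lemma eq_zero_of_top (k : ℕ) (M : ModuleCat.{u} R)
    (z : (localCohomology (⊤ : Ideal R) (k + 1)).obj M) : z = 0 := by
  obtain ⟨t, x, rfl⟩ := exists_ι_eq ⊤ k M z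
  have h : 𝟙 (quotPow (⊤ : Ideal R) t) = 0 := by
    ext
    exact (Submodule.Quotient.mk_eq_zero _).2 (by rw [Ideal.top_pow]; trivial)
  rw [← Ext.mk₀_id_comp x, h, Ext.mk₀_zero, Ext.zero_comp, map_zero]

variable {S : ShortComplex (ModuleCat.{u} R)}

/-- The long exact sequence of local cohomology around the connecting map. -/
lemma exists_connecting_map (I : Ideal R) (hS : S.ShortExact) (k : ℕ) :
    ∃ δ : (localCohomology I (k + 1)).obj S.X₃ →ₗ[R] (localCohomology I (k + 2)).obj S.X₁,
      LinearMap.ker δ = LinearMap.range ((localCohomology I (k + 1)).map S.g).hom ∧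
      LinearMap.range δ = LinearMap.ker ((localCohomology I (k + 2)).map S.f).hom := by
  obtain ⟨δ, hδ⟩ := exists_linearMap_of_compatible I k S.X₃ ((localCohomology I (k + 2)).obj S.X₁)
    (fun t => ι I (k + 1) S.X₁ t ∘ₗ
      { toFun := fun x => x.comp hS.extClass rfl
        map_add' := fun x y => Ext.add_comp _ _ _ _
        map_smul' := fun r x => Ext.smul_comp _ _ _ _ })
    (fun t t' h x => by
      refine Eq.trans ?_ (ι_comp I (k + 1) S.X₁ h _)
      exact congrArg (ι I (k + 1) S.X₁ t') (Ext.comp_assoc _ _ _ (zero_add _) rfl (by lia)))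
  replace hδ : ∀ t x, δ (ι I k S.X₃ t x) = ι I (k + 1) S.X₁ t (x.comp hS.extClass rfl) := hδ
  refine ⟨δ, le_antisymm ?_ ?_, le_antisymm ?_ ?_⟩
  · intro z hz
    obtain ⟨t, x, rfl⟩ := exists_ι_eq I k S.X₃ z
    rw [LinearMap.mem_ker, hδ, ι_eq_zero_iff] at hz
    obtain ⟨t', h, hx⟩ := hz
    rw [← Ext.comp_assoc _ _ _ (zero_add _) _ (by lia)] at hx
    obtain ⟨w, hw⟩ := Ext.covariant_sequence_exact₃ _ hS _ rfl hx
    refine ⟨ι I k S.X₂ t' w, ?_⟩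
    refine (map_ι I k S.g t' w).trans ?_
    rw [hw, ι_comp]
  · rintro _ ⟨z, rfl⟩
    obtain ⟨t, x, rfl⟩ := exists_ι_eq I k S.X₂ z
    refine (congrArg δ (map_ι I k S.g t x)).trans ?_
    rw [hδ, Ext.comp_assoc _ _ _ (add_zero _) (zero_add _) (by lia), hS.comp_extClass,
      Ext.comp_zero, map_zero]
  · rintro _ ⟨z, rfl⟩
    obtain ⟨t, x, rfl⟩ := exists_ι_eq I k S.X₃ z
    refine (congrArg ((localCohomology I (k + 2)).map S.f) (hδ t x)).trans ?_
    rw [map_ι, Ext.comp_assoc _ _ _ rfl (add_zero _) (by lia), hS.extClass_comp,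
      Ext.comp_zero, map_zero]
  · intro z hz
    obtain ⟨t, x, rfl⟩ := exists_ι_eq I (k + 1) S.X₁ z
    replace hz : (localCohomology I (k + 2)).map S.f (ι I (k + 1) S.X₁ t x) = 0 := hz
    rw [map_ι, ι_eq_zero_iff] at hz
    obtain ⟨t', h, hx⟩ := hz
    rw [← Ext.comp_assoc _ _ _ (zero_add _) _ (by lia)] at hx
    obtain ⟨w, hw⟩ := Ext.covariant_sequence_exact₁ _ hS _ hx rfl
    refine ⟨ι I k S.X₃ t' w, ?_⟩
    rw [hδ, hw, ι_comp]

lemma finite_associatedPrimes_iff (I : Ideal R) (hS : S.ShortExact) (k : ℕ)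
    (h0 : ∀ z, (localCohomology I (k + 1)).map S.g z = 0)
    (hfin : (associatedPrimes R ((localCohomology I (k + 2)).obj S.X₂)).Finite) :
    (associatedPrimes R ((localCohomology I (k + 2)).obj S.X₁)).Finite ↔
      (associatedPrimes R ((localCohomology I (k + 1)).obj S.X₃)).Finite := by
  obtain ⟨δ, h1, h2⟩ := exists_connecting_map I hS k
  have hinj : Function.Injective δ := by
    rw [← LinearMap.ker_eq_bot, h1, LinearMap.range_eq_bot]
    exact LinearMap.ext h0
  refine ⟨fun h => h.subset (associatedPrimes.subset_of_injective hinj), fun h =>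
    (h.union hfin).subset (associatedPrimes.subset_union_of_exact hinj
      (LinearMap.exact_iff.2 h2.symm))⟩

end localCohomology

/-- A module is `I`-power torsion if each element is killed by a power of `I`. -/
def IsPowTorsion {R : Type u} [CommRing R] (I : Ideal R) (M : Type u) [AddCommGroup M]
    [Module R M] : Prop :=
  ∀ m : M, ∃ t : ℕ, ∀ a ∈ I ^ t, a • m = 0

/-- The submodule of elements killed by a power of `I`. -/
def powTorsion {R : Type u} [CommRing R] (I : Ideal R) (M : Type u) [AddCommGroup M]
    [Module R M] : Submodule R M where
  carrier := {m | ∃ t : ℕ, ∀ a ∈ I ^ t, a • m = 0}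
  add_mem' := by
    rintro x y ⟨s, hs⟩ ⟨t, ht⟩
    refine ⟨max s t, fun a ha => ?_⟩
    rw [smul_add, hs a (Ideal.pow_le_pow_right (le_max_left s t) ha),
      ht a (Ideal.pow_le_pow_right (le_max_right s t) ha), add_zero]
  zero_mem' := ⟨0, fun a _ => smul_zero a⟩
  smul_mem' := by
    rintro r x ⟨s, hs⟩
    exact ⟨s, fun a ha => by rw [smul_comm, hs a ha, smul_zero]⟩

namespace IsPowTorsion
variable {R : Type u} [CommRing R] {I : Ideal R} {M N : Type u} [AddCommGroup M]
    [Module R M] [AddCommGroup N] [Module R N]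

lemma powTorsion_self : IsPowTorsion I (powTorsion I M) := by
  rintro ⟨m, t, ht⟩
  exact ⟨t, fun a ha => Subtype.ext (ht a ha)⟩

lemma of_surjective (h : IsPowTorsion I M) {f : M →ₗ[R] N} (hf : Function.Surjective f) :
    IsPowTorsion I N := by
  intro n
  obtain ⟨m, rfl⟩ := hf n
  obtain ⟨t, ht⟩ := h m
  exact ⟨t, fun a ha => by rw [← map_smul, ht a ha, map_zero]⟩

lemma exists_forall [IsNoetherian R M] (h : IsPowTorsion I M) :
    ∃ t : ℕ, ∀ a ∈ I ^ t, ∀ m : M, a • m = 0 := by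
  let T : ℕ →o Submodule R M :=
    ⟨fun t => Submodule.torsionBySet R M (I ^ t : Ideal R),
      fun i j h => Submodule.torsionBySet_le_torsionBySet_pow i j h I⟩
  obtain ⟨t, ht⟩ := monotone_stabilizes_iff_noetherian.2 ‹IsNoetherian R M› T
  refine ⟨t, fun a ha m => ?_⟩
  obtain ⟨s, hs⟩ := h m
  have h1 : m ∈ T (max s t) :=
    T.2 (le_max_left s t) ((Submodule.mem_torsionBySet_iff _ _).2 fun a => hs a a.2)
  rw [← ht _ (le_max_right s t)] at h1
  exact (Submodule.mem_torsionBySet_iff _ _).1 h1 ⟨a, ha⟩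

end IsPowTorsion

lemma injective_powTorsion {R : Type u} [CommRing R] [IsNoetherianRing R] (I : Ideal R)
    (E : Type u) [AddCommGroup E] [Module R E] [Module.Injective R E] :
    Module.Injective R (powTorsion I E) := by
  refine Module.Baer.injective fun B g => ?_
  obtain ⟨t, ht⟩ : ∃ t : ℕ, ∀ a ∈ I ^ t, ∀ b : B, g (a • b) = 0 := by
    have : IsPowTorsion I (LinearMap.range g) := fun ⟨⟨m, t, ht⟩, hm⟩ =>
      ⟨t, fun a ha => Subtype.ext (Subtype.ext (ht a ha))⟩
    obtain ⟨t, ht⟩ := this.exists_forall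
    exact ⟨t, fun a ha b => by
      rw [map_smul]
      exact congrArg Subtype.val (ht a ha ⟨g b, b, rfl⟩)⟩
  obtain ⟨k, hk⟩ := Ideal.exists_pow_inf_eq_pow_smul I B
  have hle : I ^ (t + k) ⊓ B ≤ I ^ t * B := by
    have := hk (t + k) (Nat.le_add_left _ _)
    rw [smul_eq_mul, Ideal.mul_top, Nat.add_sub_cancel] at this
    rw [this]
    exact Ideal.mul_mono_right inf_le_right
  have hg : Submodule.comap B.subtype (I ^ (t + k)) ≤ LinearMap.ker g := by
    have key : ∀ x ∈ I ^ t * B, ∃ h : x ∈ B, g ⟨x, h⟩ = 0 := by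
      intro x hx
      refine Submodule.mul_induction_on hx
        (fun a ha b hb => ⟨B.mul_mem_left a hb, ht a ha ⟨b, hb⟩⟩) ?_
      rintro x y ⟨hx, hx'⟩ ⟨hy, hy'⟩
      refine ⟨B.add_mem hx hy, ?_⟩
      have := map_add g ⟨x, hx⟩ ⟨y, hy⟩
      rwa [hx', hy', add_zero] at this
    intro b hb
    exact (key b (hle ⟨hb, b.2⟩)).2
  let f := Submodule.mapQ (Submodule.comap B.subtype (I ^ (t + k))) (I ^ (t + k)) B.subtype le_rfl
  have hf : Function.Injective f := by
    rw [← LinearMap.ker_eq_bot, Submodule.ker_mapQ, Submodule.mkQ_map_self]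
  obtain ⟨h, hh⟩ := Module.Injective.out f hf
    ((powTorsion I E).subtype ∘ₗ Submodule.liftQ _ g hg)
  refine ⟨LinearMap.codRestrict _ (h ∘ₗ Submodule.mkQ _) fun r => ⟨t + k, fun a ha => ?_⟩, ?_⟩
  · rw [← map_smul, LinearMap.comp_apply, Submodule.mkQ_apply,
      smul_eq_mul, (Submodule.Quotient.mk_eq_zero _).2 (Ideal.mul_mem_right r _ ha), map_zero]
  · intro x hx
    exact Subtype.ext (hh (Submodule.Quotient.mk ⟨x, hx⟩))

lemma exists_shortExact_of_isPowTorsion {R : Type u} [CommRing R] [IsNoetherianRing R] (I : Ideal R)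
    (N : ModuleCat.{u} R) (hN : IsPowTorsion I N) :
    ∃ (E C : ModuleCat.{u} R) (f : N ⟶ E) (g : E ⟶ C) (w : f ≫ g = 0),
      (ShortComplex.mk f g w).ShortExact ∧ Injective E ∧ IsPowTorsion I E ∧ IsPowTorsion I C := by
  obtain ⟨⟨E₀, _, i, _⟩⟩ := EnoughInjectives.presentation N
  have : Module.Injective R E₀ := Module.injective_module_of_injective_object R E₀
  have := injective_powTorsion I E₀
  let f : N →ₗ[R] powTorsion I E₀ :=
    LinearMap.codRestrict _ i.hom fun n => by
      obtain ⟨t, ht⟩ := hN n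
      exact ⟨t, fun a ha => by rw [← map_smul, ht a ha, map_zero]⟩
  have hf : Function.Injective f := fun x y h =>
    (ModuleCat.mono_iff_injective i).1 inferInstance (congrArg Subtype.val h)
  have w : ModuleCat.ofHom f ≫ ModuleCat.ofHom (LinearMap.range f).mkQ = 0 := by
    ext x
    exact (Submodule.Quotient.mk_eq_zero _).2 ⟨x, rfl⟩
  have : Mono (ModuleCat.ofHom f) := (ModuleCat.mono_iff_injective _).2 hf
  have : Epi (ModuleCat.ofHom (LinearMap.range f).mkQ) :=
    (ModuleCat.epi_iff_surjective _).2 (Submodule.mkQ_surjective _)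
  refine ⟨ModuleCat.of R (powTorsion I E₀), ModuleCat.of R (_ ⧸ LinearMap.range f),
    ModuleCat.ofHom f, ModuleCat.ofHom (Submodule.mkQ _), w, { exact := ?_ },
    Module.injective_object_of_injective_module R _, IsPowTorsion.powTorsion_self,
    IsPowTorsion.powTorsion_self.of_surjective (Submodule.mkQ_surjective (LinearMap.range f))⟩
  exact (ShortComplex.moduleCat_exact_iff _).2 fun x hx => (Submodule.Quotient.mk_eq_zero _).1 hx

namespace localCohomology
variable {R : Type u} [CommRing R]

lemma exists_proj_comp_eq_zero [IsNoetherianRing R] (I : Ideal R) (m : ℕ) (N : ModuleCat.{u} R)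
    (hN : IsPowTorsion I N) (t : ℕ) (x : Abelian.Ext.{u} (quotPow I t) N (m + 1)) :
    ∃ (t' : ℕ) (h : t ≤ t'), (Ext.mk₀ (proj I h)).comp x (zero_add _) = 0 := by
  obtain ⟨E, C, f, g, w, hS, hE, hET, hCT⟩ := exists_shortExact_of_isPowTorsion I N hN
  obtain ⟨c, hc⟩ := Ext.covariant_sequence_exact₁ _ hS x (Ext.eq_zero_of_injective _) rfl
  suffices ∃ (t' : ℕ) (h : t ≤ t') (y : Abelian.Ext.{u} (quotPow I t') E m),
      (Ext.mk₀ (proj I h)).comp c (zero_add _) = y.comp (Ext.mk₀ g) (add_zero _) by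
    obtain ⟨t', h, y, hy⟩ := this
    refine ⟨t', h, ?_⟩
    rw [← hc, ← Ext.comp_assoc _ _ _ (zero_add _) rfl (by lia), hy,
      Ext.comp_assoc _ _ _ (add_zero _) (zero_add _) (by lia)]
    exact (congrArg (fun z => y.comp z rfl) hS.comp_extClass).trans (Ext.comp_zero _ _ _ _ _)
  match m with
  | 0 =>
    obtain ⟨c, rfl⟩ := Ext.homEquiv₀.symm.surjective c
    obtain ⟨e, he⟩ := (ModuleCat.epi_iff_surjective g).1 hS.epi_g (c (Ideal.Quotient.mk _ 1))
    obtain ⟨s, hs⟩ := hET e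
    have h : t ≤ max s t := le_max_right s t
    let φ : quotPow I (max s t) ⟶ E := ModuleCat.ofHom
      (Submodule.liftQ (I ^ (max s t)) (LinearMap.toSpanSingleton R E e) fun a ha =>
        hs a (Ideal.pow_le_pow_right (le_max_left s t) ha))
    refine ⟨max s t, h, Ext.mk₀ φ, ?_⟩
    rw [Ext.mk₀_comp_mk₀]
    refine (Ext.mk₀_comp_mk₀ _ _).trans (congrArg _ ?_)
    ext
    refine Eq.trans ?_ (congrArg g (one_smul R e).symm)
    exact he.symm
  | m + 1 =>
    obtain ⟨t', h, hx⟩ := exists_proj_comp_eq_zero I m C hCT t c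
    exact ⟨t', h, 0, by rw [hx, Ext.zero_comp]⟩

end localCohomology

end LocalCohomology

section
open CategoryTheory Abelian Submodule
variable {R : Type u} [CommRing R]

lemma CategoryTheory.Abelian.Ext.comp_mk₀_smulShortComplex_f {X M : ModuleCat.{u} R} (r : R) {n : ℕ}
    (x : Ext.{u} X M n) : x.comp (Ext.mk₀ (M.smulShortComplex r).f) (add_zero n) = r • x := by
  rw [Ext.smul_eq_comp_mk₀, ModuleCat.smulShortComplex_f_eq_smul_id]
  rfl

/-- If `S` kills `Hom(X, M / rs M)` elementwise, it kills `Ext` in degree the length of `rs`. -/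
lemma exists_mem_smul_ext_eq_zero (S : Submonoid R) (X : ModuleCat.{u} R) (rs : List R)
    (M : ModuleCat.{u} R) (hreg : IsWeaklyRegular M rs)
    (hX : ∀ r ∈ rs, ∃ j : ℕ, ∀ x : X, r ^ j • x = 0)
    (h0 : ∀ f : X →ₗ[R] M ⧸ (Ideal.ofList rs • ⊤ : Submodule R M), ∃ s ∈ S, s • f = 0)
    (x : Ext.{u} X M rs.length) : ∃ s ∈ S, s • x = 0 := by
  induction rs generalizing M with
  | nil =>
    obtain ⟨f, rfl⟩ := Ext.homEquiv₀.symm.surjective x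
    obtain ⟨s, hs, hf⟩ := h0 (mkQ _ ∘ₗ f.hom)
    refine ⟨s, hs, ?_⟩
    have hsf : s • f = 0 := by
      ext y
      have := LinearMap.congr_fun hf y
      rw [← LinearMap.comp_smul] at this
      have h1 := (Submodule.Quotient.mk_eq_zero _).1 this
      rw [Ideal.ofList_nil, bot_smul] at h1
      exact h1
    change s • Ext.mk₀ f = 0
    rw [← Ext.mk₀_smul, hsf, Ext.mk₀_zero]
  | cons r rs ih =>
    rw [isWeaklyRegular_cons_iff] at hreg
    have hS := hreg.1.smulShortComplex_shortExact
    have hS3 : ∀ w : Ext.{u} X (M.smulShortComplex r).X₃ rs.length, ∃ s ∈ S, s • w = 0 := by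
      refine ih (ModuleCat.of R (QuotSMulTop r M)) hreg.2
        (fun a ha => hX a (List.mem_cons_of_mem _ ha)) fun f => ?_
      let e := quotOfListConsSMulTopEquivQuotSMulTopInner M r rs
      obtain ⟨s, hs, hf⟩ := h0 (e.symm.toLinearMap ∘ₗ f)
      refine ⟨s, hs, ?_⟩
      ext y
      have := LinearMap.congr_fun hf y
      refine e.symm.injective ?_
      rw [LinearMap.smul_apply, map_smul, LinearMap.zero_apply, map_zero]
      exact this
    have key : ∀ (j : ℕ) (x : Ext.{u} X M (rs.length + 1)), r ^ j • x = 0 →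
        ∃ s ∈ S, s • x = 0 := by
      intro j
      induction j with
      | zero => exact fun x hx => ⟨1, S.one_mem, by simpa using hx⟩
      | succ j ihj =>
        intro x hx
        rw [pow_succ', mul_smul, ← Ext.comp_mk₀_smulShortComplex_f] at hx
        obtain ⟨w, hw⟩ := Ext.covariant_sequence_exact₁ _ hS _ hx rfl
        obtain ⟨s, hs, hsw⟩ := hS3 w
        obtain ⟨s', hs', h⟩ := ihj (s • x) (by
          rw [smul_comm, ← hw]
          exact (Ext.smul_comp _ _ _ _).symm.trans (by rw [hsw, Ext.zero_comp]; rfl))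
        exact ⟨s' * s, S.mul_mem hs' hs, by rw [mul_smul, h]⟩
    obtain ⟨j, hj⟩ := hX r List.mem_cons_self
    refine key j x ?_
    have h1 : r ^ j • 𝟙 X = 0 := by
      ext y
      exact hj y
    rw [← Ext.mk₀_id_comp x]
    exact (Ext.smul_comp _ _ _ _).symm.trans
      (by rw [← Ext.mk₀_smul, h1, Ext.mk₀_zero, Ext.zero_comp])

lemma subsingleton_linearMap_of_subsingleton_ext (X : ModuleCat.{u} R) (rs : List R)
    (M : ModuleCat.{u} R) (hreg : IsWeaklyRegular M rs)
    (h0 : ∀ i ≤ rs.length, Subsingleton (Ext.{u} X M i)) :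
    Subsingleton (X →ₗ[R] M ⧸ (Ideal.ofList rs • ⊤ : Submodule R M)) := by
  induction rs generalizing M with
  | nil =>
    have := h0 0 le_rfl
    have : Subsingleton (X →ₗ[R] M) := (Ext.addEquiv₀.trans ModuleCat.homAddEquiv).symm.subsingleton
    have e := quotEquivOfEqBot (Ideal.ofList ([] : List R) • ⊤ : Submodule R M)
      (by rw [Ideal.ofList_nil, bot_smul])
    exact (LinearEquiv.congrRight (R := R) (M := X) e).toEquiv.subsingleton
  | cons r rs ih =>
    rw [isWeaklyRegular_cons_iff] at hreg
    have hS := hreg.1.smulShortComplex_shortExact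
    have := ih (ModuleCat.of R (QuotSMulTop r M)) hreg.2 fun i hi => by
      refine subsingleton_of_forall_eq 0 fun w => ?_
      have := h0 i (hi.trans (Nat.le_succ _))
      have := h0 (i + 1) (Nat.succ_le_succ hi)
      obtain ⟨v, hv⟩ := Ext.covariant_sequence_exact₃ _ hS w rfl
        (Subsingleton.elim (α := Ext.{u} X M (i + 1)) _ _)
      rw [← hv, Subsingleton.elim (α := Ext.{u} X M i) v 0]
      exact Ext.zero_comp _ _ _ _ _
    exact (LinearEquiv.congrRight (R := R) (M := X)
      (quotOfListConsSMulTopEquivQuotSMulTopInner M r rs)).toEquiv.subsingleton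

lemma depthIn_eq_length_of_depthIn_quotient_eq_zero [IsNoetherianRing R] {I : Ideal R} (hI : I ≠ ⊤)
    {rs : List R} (hrs : ∀ r ∈ rs, r ∈ I) (hreg : IsRegular R rs)
    (h : depthIn I (R ⧸ Ideal.ofList rs) = 0) : depthIn I R = rs.length := by
  refine le_antisymm ?_ (le_sSup ⟨rs, rfl, hrs, hreg⟩)
  by_contra! hlt
  obtain ⟨_, ⟨rs', rfl, hrs', hreg'⟩, hlt⟩ := lt_sSup_iff.1 hlt
  rw [Nat.cast_lt] at hlt
  have hext := ModuleCat.subsingleton_ext_of_exists_isRegular I (ModuleCat.of R (R ⧸ I))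
    (by rw [Module.support_eq_zeroLocus, Ideal.annihilator_quotient]) (ModuleCat.of R R)
    (by simpa [lt_top_iff_ne_top] using hI) rs' hrs' hreg'
  have := subsingleton_linearMap_of_subsingleton_ext (ModuleCat.of R (R ⧸ I)) rs (ModuleCat.of R R)
    hreg.toIsWeaklyRegular fun i hi => hext i (hi.trans_lt hlt)
  have heq : (Ideal.ofList rs • ⊤ : Ideal R) = Ideal.ofList rs := by
    rw [smul_eq_mul, Ideal.mul_top]
  have : Subsingleton ((R ⧸ I) →ₗ[R] R ⧸ Ideal.ofList rs) :=
    (LinearEquiv.congrRight (R := R) (M := R ⧸ I) (quotEquivOfEq _ _ heq)).symm.toEquiv.subsingleton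
  obtain ⟨r, hr, hreg⟩ := IsSMulRegular.subsingleton_linearMap_iff.1 this
  rw [Ideal.annihilator_quotient] at hr
  have hle : (1 : ℕ∞) ≤ depthIn I (R ⧸ Ideal.ofList rs) := by
    refine le_sSup ⟨[r], rfl, by simpa using hr, ?_, ?_⟩
    · rw [isWeaklyRegular_singleton_iff]
      exact hreg
    · intro htop
      refine hI (Ideal.eq_top_iff_one _ |>.2 ?_)
      have h1 : (Submodule.Quotient.mk 1 : R ⧸ Ideal.ofList rs) ∈
        (Ideal.ofList [r] • ⊤ : Submodule R (R ⧸ Ideal.ofList rs)) := htop ▸ mem_top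
      rw [Ideal.ofList_singleton, ideal_span_singleton_smul, mem_smul_pointwise_iff_exists] at h1
      obtain ⟨y, -, hy⟩ := h1
      obtain ⟨b, rfl⟩ := Submodule.Quotient.mk_surjective _ y
      rw [← Submodule.Quotient.mk_smul, Submodule.Quotient.eq] at hy
      have := I.sub_mem (I.mul_mem_right b hr) (Ideal.span_le.2 hrs hy)
      simpa using this
  rw [h] at hle
  exact absurd hle (by simp)
end

section
open CategoryTheory Abelian Submodule
variable {R : Type u} [CommRing R]

lemma IsLocallyDomain.exists_mul_mem {J P : Ideal R} [hP : P.IsPrime] (hJP : J ≤ P)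
    (hdom : IsLocallyDomain (R ⧸ J)) {a b : R} {t : ℕ} (ha : ∀ s ∉ P, s * a ∉ J)
    (hab : a ^ t * b ∈ J) : ∃ s ∉ P, s * b ∈ J := by
  let P' := P.map (Ideal.Quotient.mk J)
  have hP' : P'.IsPrime := Ideal.map_isPrime_of_surjective Ideal.Quotient.mk_surjective
    (by rwa [Ideal.mk_ker])
  have hmem (s : R) : Ideal.Quotient.mk J s ∈ P' ↔ s ∈ P := by
    rw [← Ideal.mem_comap, Ideal.comap_map_of_surjective _ Ideal.Quotient.mk_surjective,
      ← RingHom.ker_eq_comap_bot, Ideal.mk_ker, sup_eq_left.2 hJP]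
  have hzero (c : R) : algebraMap _ (Localization.AtPrime P') (Ideal.Quotient.mk J c) = 0 ↔
      ∃ s ∉ P, s * c ∈ J := by
    rw [IsLocalization.map_eq_zero_iff P'.primeCompl]
    constructor
    · rintro ⟨⟨s, hs⟩, h⟩
      obtain ⟨s, rfl⟩ := Ideal.Quotient.mk_surjective s
      refine ⟨s, fun h' => hs ((hmem s).2 h'), ?_⟩
      rwa [← map_mul, Ideal.Quotient.eq_zero_iff_mem] at h
    · rintro ⟨s, hs, h⟩
      refine ⟨⟨Ideal.Quotient.mk J s, fun h' => hs ((hmem s).1 h')⟩, ?_⟩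
      rwa [← map_mul, Ideal.Quotient.eq_zero_iff_mem]
  have := hdom P' hP'
  rw [← hzero]
  have h1 : algebraMap _ (Localization.AtPrime P') (Ideal.Quotient.mk J (a ^ t * b)) = 0 := by
    rw [Ideal.Quotient.eq_zero_iff_mem.2 hab, map_zero]
  rw [map_mul, map_mul, map_pow, map_pow] at h1
  refine (mul_eq_zero.1 h1).resolve_left (pow_ne_zero _ fun h => ?_)
  obtain ⟨s, hs, h⟩ := (hzero a).1 h
  exact ha s hs h

lemma Ideal.exists_forall_mul_mem [IsNoetherianRing R] {I J P : Ideal R} [hP : P.IsPrime]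
    (h : ∀ a ∈ I, ∃ s ∉ P, s * a ∈ J) : ∃ s ∉ P, ∀ a ∈ I, s * a ∈ J := by
  induction I, IsNoetherian.noetherian I using Submodule.fg_induction with
  | singleton x =>
    obtain ⟨s, hs, h⟩ := h x (mem_span_singleton_self x)
    refine ⟨s, hs, fun a ha => ?_⟩
    obtain ⟨r, rfl⟩ := mem_span_singleton.1 ha
    rw [← mul_assoc]
    exact J.mul_mem_right r h
  | sup I₁ I₂ _ _ h₁ h₂ =>
    obtain ⟨s₁, hs₁, h₁⟩ := h₁ fun a ha => h a (mem_sup_left ha)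
    obtain ⟨s₂, hs₂, h₂⟩ := h₂ fun a ha => h a (mem_sup_right ha)
    refine ⟨s₁ * s₂, fun h => (hP.mem_or_mem h).elim hs₁ hs₂, fun a ha => ?_⟩
    obtain ⟨a₁, ha₁, a₂, ha₂, rfl⟩ := mem_sup.1 ha
    rw [mul_add]
    exact J.add_mem (by rw [mul_right_comm]; exact J.mul_mem_right _ (h₁ _ ha₁))
      (by rw [mul_assoc]; exact J.mul_mem_left _ (h₂ _ ha₂))

namespace localCohomology

lemma smul_ι_eq_zero_of_pow_torsion_range [IsNoetherianRing R] {I : Ideal R} {k : ℕ}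
    {M : ModuleCat.{u} R} {s : R} (hs : ∀ a ∈ I, ∀ m : M, a • s • m = 0) (t : ℕ)
    (x : Ext.{u} (quotPow I t) M (k + 1)) : s • ι I k M t x = 0 := by
  let f : M →ₗ[R] M := LinearMap.lsmul R M s
  let π : M ⟶ ModuleCat.of R (LinearMap.range f) := ModuleCat.ofHom f.rangeRestrict
  let i : ModuleCat.of R (LinearMap.range f) ⟶ M := ModuleCat.ofHom (LinearMap.range f).subtype
  have hπi : π ≫ i = s • 𝟙 M := by
    ext m
    rfl
  obtain ⟨t', h, hx⟩ := exists_proj_comp_eq_zero I k (ModuleCat.of R (LinearMap.range f))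
    (fun ⟨m, hm⟩ => ⟨1, fun a ha => by
      obtain ⟨m, rfl⟩ := hm
      exact Subtype.ext (hs a (by simpa using ha) m)⟩) t (x.comp (Ext.mk₀ π) (add_zero _))
  rw [← map_smul, ι_eq_zero_iff]
  refine ⟨t', h, ?_⟩
  have h1 : s • x = (x.comp (Ext.mk₀ π) (add_zero _)).comp (Ext.mk₀ i) (add_zero _) := by
    rw [Ext.comp_assoc _ _ _ (add_zero _) (add_zero _) (by lia), Ext.mk₀_comp_mk₀, hπi]
    exact Ext.smul_eq_comp_mk₀ _ _
  rw [h1, ← Ext.comp_assoc _ _ _ (zero_add _) (add_zero _) (by lia), hx]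
  exact Ext.zero_comp _ _ _ _ _

lemma map_mkQ_eq_zero [IsNoetherianRing R] {I : Ideal R} {rs : List R} (hrs : ∀ r ∈ rs, r ∈ I)
    (hreg : IsWeaklyRegular R rs) (hdom : IsLocallyDomain (R ⧸ Ideal.ofList rs)) {k : ℕ}
    (hk : rs.length = k + 1) (z : (localCohomology I (k + 1)).obj (ModuleCat.of R R)) :
    (localCohomology I (k + 1)).map (ModuleCat.ofHom (mkQ (Ideal.ofList rs))) z = 0 := by
  obtain ⟨t, x, rfl⟩ := exists_ι_eq I k _ z
  rw [map_ι]
  set J := Ideal.ofList rs with hJ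
  set y := x.comp (Ext.mk₀ (ModuleCat.ofHom (mkQ J))) (add_zero _) with hy
  by_contra hne
  let η := ι I k (ModuleCat.of R (R ⧸ J)) t y
  obtain ⟨P, hP, hle⟩ := Ideal.exists_le_maximal (Ideal.torsionOf R _ η) fun h => hne (by
    have : (1 : R) ∈ Ideal.torsionOf R _ η := h ▸ mem_top
    simpa [η] using this)
  have hP' : P.IsPrime := hP.isPrime
  have hJ0 {r : R} (hr : r ∈ J) (m : R ⧸ J) : r • m = 0 := by
    obtain ⟨b, rfl⟩ := Submodule.Quotient.mk_surjective _ m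
    exact (Submodule.Quotient.mk_eq_zero _).2 (J.mul_mem_right b hr)
  have hJP : J ≤ P := fun r hr => hle (by
    rw [Ideal.mem_torsionOf_iff]
    exact smul_ι_eq_zero_of_pow_torsion_range (M := ModuleCat.of R (R ⧸ J))
      (fun a _ m => (congrArg (a • ·) (hJ0 hr m)).trans (smul_zero a)) t y)
  by_cases h : ∀ a ∈ I, ∃ s ∉ P, s * a ∈ J
  · obtain ⟨s, hs, h⟩ := Ideal.exists_forall_mul_mem h
    refine hs (hle ((Ideal.mem_torsionOf_iff _ _).2
      (smul_ι_eq_zero_of_pow_torsion_range (M := ModuleCat.of R (R ⧸ J)) (fun a ha m => ?_) t y)))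
    rw [← mul_smul, mul_comm]
    exact hJ0 (h a ha) m
  · push Not at h
    obtain ⟨a, ha, h⟩ := h
    have heq : (J • ⊤ : Ideal R) = J := by rw [smul_eq_mul, Ideal.mul_top]
    obtain ⟨s, hs, hx⟩ : ∃ s ∈ P.primeCompl, s • x = 0 := by
      have hkill {c : R} (hc : c ∈ I) (q : R ⧸ I ^ t) : c ^ t • q = 0 := by
        obtain ⟨b, rfl⟩ := Submodule.Quotient.mk_surjective _ q
        exact (Submodule.Quotient.mk_eq_zero _).2 (Ideal.mul_mem_right b _ (Ideal.pow_mem_pow hc t))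
      have key := exists_mem_smul_ext_eq_zero P.primeCompl (quotPow I t) rs (ModuleCat.of R R) hreg
        (fun r hr => ⟨t, hkill (hrs r hr)⟩) fun f => by
          obtain ⟨b, hb⟩ := Submodule.Quotient.mk_surjective _ (f (Ideal.Quotient.mk _ 1))
          have hab : a ^ t * b ∈ J := by
            rw [← heq]
            refine (Submodule.Quotient.mk_eq_zero _).1 ?_
            refine (congrArg (a ^ t • ·) hb).trans ?_
            refine (map_smul f (a ^ t) _).symm.trans ?_
            exact (congrArg f (hkill ha _)).trans (map_zero f)
          obtain ⟨s, hs, hsb⟩ := hdom.exists_mul_mem hJP h hab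
          refine ⟨s, hs, ?_⟩
          refine Submodule.linearMap_qext _ (LinearMap.ext_ring ?_)
          refine (congrArg (s • ·) hb).symm.trans ?_
          rw [← heq] at hsb
          exact (Submodule.Quotient.mk_eq_zero _).2 hsb
      rw [hk] at key
      exact key x
    refine hs (hle ((Ideal.mem_torsionOf_iff _ _).2 ?_))
    rw [← map_smul, hy, ← Ext.smul_comp, hx, Ext.zero_comp, map_zero]

end localCohomology
end

/-- Let `R` be a Noetherian ring, `J` an ideal generated by an `R`-regular
sequence of length at least 2, `I ⊇ J`, `d = depth_I(R)`.  Suppose `Ass H_I^{d+1}(R)` is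
finite, `depth_I(R/J) = 0`, and `R/J` is Cohen–Macaulay and locally a domain.  Then
`Ass H_I^{d+1}(J)` is finite iff `Ass H_I^d(R/J)` is finite. -/
theorem associatedPrimes_finite_iff_of_depth_quot_zero
    (R : Type u) [CommRing R] [IsNoetherianRing R]
    (J I : Ideal R) (hJI : J ≤ I)
    (rs : List R) (hlen : 2 ≤ rs.length) (hreg : IsRegular R rs) (hJ : J = Ideal.ofList rs)
    (d : ℕ) (hd : depthIn I R = (d : ℕ∞))
    (hfin : (associatedPrimes R ((localCohomology I (d + 1)).obj (ModuleCat.of R R))).Finite)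
    (hdepth0 : depthIn I (R ⧸ J) = 0)
    (hCM : IsCohenMacaulayRing (R ⧸ J))
    (hdom : IsLocallyDomain (R ⧸ J)) :
    (associatedPrimes R ((localCohomology I (d + 1)).obj (ModuleCat.of R ↥J))).Finite ↔
      (associatedPrimes R ((localCohomology I d).obj (ModuleCat.of R (R ⧸ J)))).Finite := by
  have hJI' : ∀ r ∈ rs, r ∈ I := fun r hr => hJI (hJ ▸ Ideal.subset_span hr)
  have hrs : (rs.length : ℕ∞) ≤ d := hd ▸ le_sSup ⟨rs, rfl, hJI', hreg⟩
  rw [Nat.cast_le] at hrs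
  obtain ⟨k, rfl⟩ : ∃ k, d = k + 1 := ⟨d - 1, by lia⟩
  have hS : (CategoryTheory.ShortComplex.mk (ModuleCat.ofHom J.subtype) (ModuleCat.ofHom J.mkQ)
      (by ext x; exact (Submodule.Quotient.mk_eq_zero J).2 x.2)).ShortExact :=
    { exact := (CategoryTheory.ShortComplex.moduleCat_exact_iff _).2 fun x hx =>
        ⟨⟨x, (Submodule.Quotient.mk_eq_zero J).1 hx⟩, rfl⟩
      mono_f := (ModuleCat.mono_iff_injective _).2 J.injective_subtype
      epi_g := (ModuleCat.epi_iff_surjective _).2 J.mkQ_surjective }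
  refine localCohomology.finite_associatedPrimes_iff I hS k (fun z => ?_) hfin
  by_cases hI : I = ⊤
  · subst hI
    exact localCohomology.eq_zero_of_top k _ _
  · subst hJ
    have hlen' := depthIn_eq_length_of_depthIn_quotient_eq_zero hI hJI' hreg hdepth0
    rw [hd, Nat.cast_inj] at hlen'
    exact localCohomology.map_mkQ_eq_zero hJI' hreg.toIsWeaklyRegular hdom hlen'.symm z
end

section
/- Let A be a Cohen–Macaulay Noetherian ring with dim A > 0 and let I be an ideal of A with depth_I(A) = 0. If A is locally a domain (i.e. A_P is a domain for every prime P), then there exist an element a ∈ A and an ideal I_0 of A with depth_{I_0}(A) > 0 such that the radical of I equals √(aA) ∩ I_0. -/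
universe u

open RingTheory.Sequence

open nonZeroDivisors in
/-- In a ring with a nonunit nonzerodivisor, every ideal containing a nonzerodivisor has positive
depth. -/
lemma depthIn_pos_of_nonZeroDivisor {A : Type u} [CommRing A] {x : A}
    (hx : x ∈ A⁰) (hxu : ¬ IsUnit x) {J : Ideal A} {y : A} (hy : y ∈ A⁰) (hyJ : y ∈ J) :
    0 < depthIn J A := by
  obtain ⟨z, hz, hzu, hzJ⟩ : ∃ z ∈ A⁰, ¬ IsUnit z ∧ z ∈ J := by
    by_cases hyu : IsUnit y
    · exact ⟨x, hx, hxu, J.eq_top_of_isUnit_mem hyJ hyu ▸ Submodule.mem_top⟩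
    · exact ⟨y, hy, hyu, hyJ⟩
  refine zero_lt_one.trans_le (le_sSup ⟨[z], by simp, by simpa using hzJ, ?_, ?_⟩)
  · rw [isWeaklyRegular_singleton_iff, isSMulRegular_iff_right_eq_zero_of_smul]
    exact fun w hw => (mem_nonZeroDivisors_iff.mp hz).1 w hw
  · rw [Ideal.ofList_singleton, smul_eq_mul, Ideal.mul_top]
    exact fun h => hzu (Ideal.span_singleton_eq_top.mp h.symm)

/-- In a ring that is locally a domain, a vanishing product has a factor vanishing near any given
prime. -/
lemma IsLocallyDomain.exists_notMem_mul_eq_zero {A : Type u} [CommRing A]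
    (hdom : IsLocallyDomain A) (P : Ideal A) [hP : P.IsPrime] {a b : A} (hab : a * b = 0) :
    (∃ s ∉ P, s * a = 0) ∨ ∃ s ∉ P, s * b = 0 := by
  have := hdom P hP
  have key (c : A) (hc : algebraMap A (Localization.AtPrime P) c = 0) : ∃ s ∉ P, s * c = 0 := by
    obtain ⟨⟨s, hs⟩, h⟩ := (IsLocalization.map_eq_zero_iff P.primeCompl _ c).mp hc
    exact ⟨s, hs, h⟩
  have h : algebraMap A (Localization.AtPrime P) a * algebraMap A _ b = 0 := by
    rw [← map_mul, hab, map_zero]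
  exact (mul_eq_zero.mp h).imp (key a) (key b)

/-- If each element of a finitely generated ideal vanishes near `P`, then so does the ideal. -/
lemma Ideal.FG.exists_mem_annihilator_notMem {A : Type*} [CommRing A] {J : Ideal A} (hJ : J.FG)
    (P : Ideal A) [hP : P.IsPrime] (h : ∀ j ∈ J, ∃ s ∉ P, s * j = 0) :
    ∃ s ∈ Module.annihilator A J, s ∉ P := by
  obtain ⟨S, rfl⟩ := hJ
  choose! t htP ht using h
  refine ⟨∏ j ∈ S, t j, ?_, ?_⟩
  · rw [← Submodule.annihilator, Submodule.mem_annihilator_span]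
    rintro ⟨j, hj⟩
    obtain ⟨c, hc⟩ := Finset.dvd_prod_of_mem t hj
    rw [hc, smul_eq_mul, mul_right_comm, ht j (Ideal.subset_span hj), zero_mul]
  · rw [hP.prod_mem_iff]
    rintro ⟨j, hj, hjP⟩
    exact htP j (Ideal.subset_span hj) hjP

lemma IsLocallyDomain.isIdempotentElem_annihilator {A : Type u} [CommRing A]
    (hdom : IsLocallyDomain A) {J : Ideal A} (hJ : J.FG) :
    IsIdempotentElem (Module.annihilator A J) := by
  refine le_antisymm Ideal.mul_le_left fun x hx => ?_
  set K := Module.annihilator A J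
  by_contra hxK
  have hne : Submodule.colon (K * K) {x} ≠ ⊤ := fun h =>
    hxK (by simpa [Submodule.mem_colon_singleton] using (Ideal.eq_top_iff_one _).mp h)
  obtain ⟨m, hm, hle⟩ := Ideal.exists_le_maximal _ hne
  have hmP := hm.isPrime
  obtain ⟨s, hsK, hsm⟩ := hJ.exists_mem_annihilator_notMem m fun j hj => by
    refine (hdom.exists_notMem_mul_eq_zero m
      (Submodule.mem_annihilator.mp hx j hj)).resolve_left ?_
    rintro ⟨s, hsm, hs⟩
    refine hsm (hle (Submodule.mem_colon_singleton.mpr ?_))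
    rw [smul_eq_mul, hs]
    exact zero_mem _
  exact hsm (hle (Submodule.mem_colon_singleton.mpr (Ideal.mul_mem_mul hsK hx)))

open nonZeroDivisors in
lemma Ideal.exists_mem_nonZeroDivisors {A : Type*} [CommRing A] [IsNoetherianRing A] {J : Ideal A}
    (hJ : Module.annihilator A J = ⊥) : ∃ x ∈ A⁰, x ∈ J := by
  by_contra! h
  exact (Ideal.bot_lt_annihilator_of_disjoint_nonZeroDivisors
    (Set.disjoint_left.mpr fun x hxJ hx => h x hx hxJ)).ne' hJ

/-- In a ring that is locally a domain, a nonminimal prime is faithful. -/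
lemma IsLocallyDomain.annihilator_eq_bot_of_lt {A : Type u} [CommRing A]
    (hdom : IsLocallyDomain A) {P Q : Ideal A} [hP : P.IsPrime] (hPQ : P < Q) :
    Module.annihilator A Q = ⊥ := by
  rw [eq_bot_iff]
  intro y hy
  by_contra hy0
  have hne : Submodule.colon (⊥ : Ideal A) {y} ≠ ⊤ := fun h =>
    hy0 (by simpa [Submodule.mem_colon_singleton] using (Ideal.eq_top_iff_one _).mp h)
  obtain ⟨m, hm, hle⟩ := Ideal.exists_le_maximal _ hne
  have hmP := hm.isPrime
  have hQm : Q ≤ m := fun q hq => hle <| Submodule.mem_colon_singleton.mpr <| by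
    rw [smul_eq_mul, mul_comm]
    exact Submodule.mem_annihilator.mp hy q hq
  refine hPQ.not_ge fun q hq => ?_
  obtain ⟨s, hsm, hs⟩ := (hdom.exists_notMem_mul_eq_zero m
    (Submodule.mem_annihilator.mp hy q hq)).resolve_left fun ⟨s, hsm, hs⟩ =>
      hsm (hle (Submodule.mem_colon_singleton.mpr hs))
  exact (hP.mem_or_mem (hs ▸ P.zero_mem)).resolve_left fun hsP => hsm (hQm (hPQ.le hsP))

/-- Let `A` be a Cohen–Macaulay Noetherian ring with `dim A > 0` and `I`
an ideal with `depth_I(A) = 0`.  If `A` is locally a domain, then `√I = √(aA) ∩ I₀` for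
some `a ∈ A` and some ideal `I₀` with `depth_{I₀}(A) > 0`. -/
theorem radical_eq_inf_of_depth_zero
    (A : Type u) [CommRing A] [IsNoetherianRing A]
    (hCM : IsCohenMacaulayRing A) (hdim : 0 < ringKrullDim A)
    (I : Ideal A) (hdepth : depthIn I A = 0)
    (hdom : IsLocallyDomain A) :
    ∃ (a : A) (I₀ : Ideal A), 0 < depthIn I₀ A ∧
      I.radical = (Ideal.span {a}).radical ⊓ I₀ := by
  obtain ⟨P, Q, hPQ⟩ := Order.krullDim_pos_iff.mp hdim
  have := P.isPrime
  obtain ⟨x, hx, hxQ⟩ := Ideal.exists_mem_nonZeroDivisors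
    (hdom.annihilator_eq_bot_of_lt (show P.asIdeal < Q.asIdeal from hPQ))
  have hxu : ¬ IsUnit x := fun h => Q.isPrime.ne_top (Ideal.eq_top_of_isUnit_mem _ hxQ h)
  obtain ⟨f, hf, hfK⟩ := (Ideal.isIdempotentElem_iff_of_fg _ (IsNoetherian.noetherian _)).mp
    (hdom.isIdempotentElem_annihilator (IsNoetherian.noetherian I.radical))
  have hmem (j : A) (hj : j ∈ I.radical) : f * j = 0 :=
    Submodule.mem_annihilator.mp (hfK.ge (Ideal.mem_span_singleton_self f)) j hj
  refine ⟨1 - f, I.radical ⊔ Ideal.span {f}, ?_, le_antisymm (le_inf ?_ le_sup_left) ?_⟩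
  · obtain ⟨y, hy, hyJ⟩ := Ideal.exists_mem_nonZeroDivisors
      (J := I.radical ⊔ Ideal.span {f}) <| by
        rw [eq_bot_iff]
        intro z hz
        have hz' := Submodule.mem_annihilator.mp hz
        have hzK : z ∈ Module.annihilator A I.radical :=
          Submodule.mem_annihilator.mpr fun j hj => hz' j (Ideal.mem_sup_left hj)
        have hzf : z * f = 0 := hz' f (Ideal.mem_sup_right (Ideal.mem_span_singleton_self f))
        rw [hfK] at hzK
        obtain ⟨c, rfl⟩ := Ideal.mem_span_singleton'.mp hzK
        rwa [mul_assoc, hf.eq] at hzf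
    exact depthIn_pos_of_nonZeroDivisor hx hxu hy hyJ
  · refine fun j hj => Ideal.le_radical (Ideal.mem_span_singleton'.mpr ⟨j, ?_⟩)
    linear_combination -hmem j hj
  · rintro y ⟨⟨n, hn⟩, hy⟩
    obtain ⟨j, hj, w, hw, rfl⟩ := Submodule.mem_sup.mp hy
    obtain ⟨c, rfl⟩ := Ideal.mem_span_singleton'.mp hw
    obtain ⟨d, hd⟩ := Ideal.mem_span_singleton'.mp hn
    rw [← I.radical_idem]
    refine ⟨n + 1, ?_⟩
    have : (j + c * f) ^ (n + 1) = (j + c * f) ^ n * j := by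
      have hff := hf.eq
      rw [pow_succ, ← hd]
      linear_combination (-d * c) * hff
    rw [this]
    exact Ideal.mul_mem_left _ _ hj
end

section
/- Let A be a Noetherian ring, I_0 an ideal of A, and x_1, ..., x_e ∈ A elements such that the ideal (x_e x_1, x_e x_2, ..., x_e x_{e−1})A is contained in I_0. Let I be an ideal of A whose radical equals √(x_e A ∩ I_0 + (x_1, ..., x_{e−1})A). Then for every A-module M and every integer i > e, there is an isomorphism H_I^i(M) ≅ H_{x_e A ∩ I_0}^i(M). -/
universe u

open RingTheory.Sequence

namespace ProExt

open CategoryTheory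

section Abelian

variable {C : Type*} [Category C] [Abelian C] [HasExt.{u} C]

/-- The contravariant functoriality of `Ext` groups. -/
noncomputable def pullback {X Y : C} (f : X ⟶ Y) (M : C) (i : ℕ) :
    Abelian.Ext.{u} Y M i →+ Abelian.Ext.{u} X M i :=
  (Abelian.Ext.mk₀ f).precomp M (zero_add i)

variable {X Y Z M : C} {i : ℕ}

lemma pullback_apply (f : X ⟶ Y) (e : Abelian.Ext.{u} Y M i) :
    pullback f M i e = (Abelian.Ext.mk₀ f).comp e (zero_add i) := rfl

lemma pullback_pullback (f : X ⟶ Y) (g : Y ⟶ Z) (e : Abelian.Ext.{u} Z M i) :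
    pullback f M i (pullback g M i e) = pullback (f ≫ g) M i e := by
  simp [pullback_apply]

lemma pullback_id (e : Abelian.Ext.{u} X M i) : pullback (𝟙 X) M i e = e := by
  simp [pullback_apply]

lemma pullback_add (f g : X ⟶ Y) (e : Abelian.Ext.{u} Y M i) :
    pullback (f + g) M i e = pullback f M i e + pullback g M i e := by
  rw [pullback_apply, Abelian.Ext.mk₀_add, Abelian.Ext.add_comp]
  rfl

lemma pullback_neg (f : X ⟶ Y) (e : Abelian.Ext.{u} Y M i) :
    pullback (-f) M i e = -pullback f M i e := by
  simp [pullback_apply]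

/-- A morphism factoring through a projective object is zero on higher `Ext` groups. -/
lemma pullback_eq_zero_of_projective (f : X ⟶ Y) (g : Y ⟶ Z) [Projective Y]
    (e : Abelian.Ext.{u} Z M (i + 1)) : pullback (f ≫ g) M (i + 1) e = 0 := by
  rw [← pullback_pullback, (pullback g M (i + 1) e).eq_zero_of_projective, map_zero]

/-- Let `φ` be a morphism of short exact sequences which is zero on `Extⁱ` of the first terms.
Then on `Extⁱ⁺¹` of the third terms it kills the classes vanishing on the middle term. -/
lemma pullback_τ₃_eq_zero {S T : ShortComplex C} (hS : S.ShortExact) (hT : T.ShortExact)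
    (φ : S ⟶ T) (h : ∀ e : Abelian.Ext.{u} T.X₁ M i, pullback φ.τ₁ M i e = 0)
    (e : Abelian.Ext.{u} T.X₃ M (i + 1)) (he : pullback T.g M (i + 1) e = 0) :
    pullback φ.τ₃ M (i + 1) e = 0 := by
  obtain ⟨c, rfl⟩ := Abelian.Ext.contravariant_sequence_exact₃ hT M e he (add_comm 1 i)
  have h0 := h c
  rw [pullback_apply] at h0 ⊢
  rw [← Abelian.Ext.comp_assoc _ _ _ (zero_add 1) (add_comm 1 i) (by lia),
    ← ShortComplex.ShortExact.extClass_naturality hS hT φ,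
    Abelian.Ext.comp_assoc _ _ _ (add_zero 1) (zero_add i) (by lia), h0, Abelian.Ext.comp_zero]

end Abelian

variable {A : Type u} [CommRing A]

/-- The canonical projection `A ⧸ J ⟶ A ⧸ K` for ideals `J ≤ K`. -/
noncomputable def quot {J K : Ideal A} (h : J ≤ K) :
    ModuleCat.of A (A ⧸ J) ⟶ ModuleCat.of A (A ⧸ K) :=
  ModuleCat.ofHom (Submodule.mapQ J K LinearMap.id h)

lemma quot_comp {J K L : Ideal A} (h : J ≤ K) (h' : K ≤ L) :
    quot h ≫ quot h' = quot (h.trans h') := by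
  ext
  rfl

/-- The restriction map `Extⁱ(A ⧸ K, M) → Extⁱ(A ⧸ J, M)` for ideals `J ≤ K`. -/
noncomputable abbrev res {J K : Ideal A} (h : J ≤ K) (M : ModuleCat.{u} A) (i : ℕ) :
    Abelian.Ext.{u} (ModuleCat.of A (A ⧸ K)) M i →+
      Abelian.Ext.{u} (ModuleCat.of A (A ⧸ J)) M i :=
  pullback (quot h) M i

lemma res_res {J K L : Ideal A} (h : J ≤ K) (h' : K ≤ L) {M : ModuleCat.{u} A} {i : ℕ}
    (e : Abelian.Ext.{u} (ModuleCat.of A (A ⧸ L)) M i) :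
    res h M i (res h' M i e) = res (h.trans h') M i e := by
  rw [pullback_pullback, quot_comp]

/-- The short complex `0 → J → A → A ⧸ J → 0`. -/
noncomputable abbrev idealShortComplex (J : Ideal A) : ShortComplex (ModuleCat.{u} A) where
  X₁ := ModuleCat.of A J
  X₂ := ModuleCat.of A A
  X₃ := ModuleCat.of A (A ⧸ J)
  f := ModuleCat.ofHom J.subtype
  g := ModuleCat.ofHom J.mkQ
  zero := by
    ext x
    exact (Submodule.Quotient.mk_eq_zero J).2 x.2

lemma idealShortComplex_shortExact (J : Ideal A) : (idealShortComplex J).ShortExact where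
  exact := by
    rw [ShortComplex.moduleCat_exact_iff]
    intro x hx
    exact ⟨⟨x, (Submodule.Quotient.mk_eq_zero J).1 hx⟩, rfl⟩
  mono_f := (ModuleCat.mono_iff_injective _).2 J.subtype_injective
  epi_g := (ModuleCat.epi_iff_surjective _).2 J.mkQ_surjective

/-- The morphism of short complexes induced by an inclusion of ideals. -/
noncomputable def idealShortComplexMap {J K : Ideal A} (h : J ≤ K) :
    idealShortComplex J ⟶ idealShortComplex K where
  τ₁ := ModuleCat.ofHom (Submodule.inclusion h)
  τ₂ := 𝟙 _
  τ₃ := quot h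
  comm₁₂ := rfl
  comm₂₃ := rfl

/-- The short complex `0 → A ⧸ (J ⊓ K) → A ⧸ J × A ⧸ K → A ⧸ (J ⊔ K) → 0`. -/
noncomputable abbrev mayerVietoris (J K : Ideal A) : ShortComplex (ModuleCat.{u} A) where
  X₁ := ModuleCat.of A (A ⧸ (J ⊓ K))
  X₂ := ModuleCat.of A ((A ⧸ J) × (A ⧸ K))
  X₃ := ModuleCat.of A (A ⧸ (J ⊔ K))
  f := ModuleCat.ofHom ((Submodule.mapQ _ _ LinearMap.id inf_le_left).prod
    (Submodule.mapQ _ _ LinearMap.id inf_le_right))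
  g := ModuleCat.ofHom ((Submodule.mapQ _ _ LinearMap.id le_sup_left).coprod
    (-Submodule.mapQ _ _ LinearMap.id le_sup_right))
  zero := by
    ext
    simp

lemma mayerVietoris_shortExact (J K : Ideal A) : (mayerVietoris J K).ShortExact where
  exact := by
    rw [ShortComplex.moduleCat_exact_iff]
    rintro ⟨x, y⟩ hxy
    obtain ⟨x, rfl⟩ := Submodule.Quotient.mk_surjective _ x
    obtain ⟨y, rfl⟩ := Submodule.Quotient.mk_surjective _ y
    have hxy' : (Submodule.Quotient.mk x : A ⧸ (J ⊔ K)) + -Submodule.Quotient.mk y = 0 := hxy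
    rw [← sub_eq_add_neg, ← Submodule.Quotient.mk_sub, Submodule.Quotient.mk_eq_zero] at hxy'
    obtain ⟨a, ha, b, hb, hab⟩ := Submodule.mem_sup.1 hxy'
    refine ⟨(Submodule.Quotient.mk (x - a) : A ⧸ (J ⊓ K)), Prod.ext ?_ ?_⟩
    · exact (Submodule.Quotient.eq J).2 (by simpa using ha)
    · exact (Submodule.Quotient.eq K).2 (by
        change x - a - y ∈ K
        rwa [show x - a - y = b by linear_combination -hab])
  mono_f := (ModuleCat.mono_iff_injective _).2 (by
    refine (injective_iff_map_eq_zero (AddMonoidHomClass.toAddMonoidHom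
      (mayerVietoris J K).f.hom)).2 fun x hx ↦ ?_
    obtain ⟨x, rfl⟩ := Submodule.Quotient.mk_surjective _ x
    have h₁ : (Submodule.Quotient.mk x : A ⧸ J) = 0 := congrArg Prod.fst hx
    have h₂ : (Submodule.Quotient.mk x : A ⧸ K) = 0 := congrArg Prod.snd hx
    exact (Submodule.Quotient.mk_eq_zero _).2
      ⟨(Submodule.Quotient.mk_eq_zero _).1 h₁, (Submodule.Quotient.mk_eq_zero _).1 h₂⟩)
  epi_g := (ModuleCat.epi_iff_surjective _).2 (by
    intro x
    obtain ⟨x, rfl⟩ := Submodule.Quotient.mk_surjective _ x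
    refine ⟨((Submodule.Quotient.mk x : A ⧸ J), (0 : A ⧸ K)), ?_⟩
    change (Submodule.Quotient.mk x : A ⧸ (J ⊔ K)) + -Submodule.Quotient.mk 0 = _
    rw [Submodule.Quotient.mk_zero, neg_zero, add_zero])

/-- The morphism of Mayer–Vietoris short complexes induced by inclusions of ideals. -/
noncomputable def mayerVietorisMap {J J' K K' : Ideal A} (hJ : J' ≤ J) (hK : K' ≤ K) :
    mayerVietoris J' K' ⟶ mayerVietoris J K where
  τ₁ := quot (inf_le_inf hJ hK)
  τ₂ := ModuleCat.ofHom ((Submodule.mapQ J' J LinearMap.id hJ).prodMap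
    (Submodule.mapQ K' K LinearMap.id hK))
  τ₃ := quot (sup_le_sup hJ hK)
  comm₁₂ := by
    ext <;> simp [quot]
  comm₂₃ := by
    apply ModuleCat.hom_ext
    apply LinearMap.prod_ext <;> ext <;> simp [quot]

section MayerVietoris

variable {J K : Ideal A} {M : ModuleCat.{u} A} {i : ℕ}

lemma pullback_mayerVietoris_g_eq_zero
    (e : Abelian.Ext.{u} (ModuleCat.of A (A ⧸ (J ⊔ K))) M i)
    (hJ : res le_sup_left M i e = 0) (hK : res le_sup_right M i e = 0) :
    pullback (mayerVietoris J K).g M i e = 0 := by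
  have h : (mayerVietoris J K).g =
      ModuleCat.ofHom (LinearMap.fst A (A ⧸ J) (A ⧸ K)) ≫ quot le_sup_left +
        ModuleCat.ofHom (LinearMap.snd A (A ⧸ J) (A ⧸ K)) ≫ (-quot le_sup_right) := by
    ext <;> rfl
  rw [h, pullback_add, ← pullback_pullback, ← pullback_pullback, pullback_neg, hJ, hK]
  simp

/-- A class on `A ⧸ (J ⊔ K)` vanishing on `A ⧸ J` and `A ⧸ K` vanishes on `A ⧸ (J' ⊔ K')`
whenever `A ⧸ (J' ⊓ K') ⟶ A ⧸ (J ⊓ K)` is zero on `Ext` groups of one degree less. -/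
lemma res_sup_eq_zero {J' K' : Ideal A} (hJ : J' ≤ J) (hK : K' ≤ K)
    (h : ∀ e, res (inf_le_inf hJ hK) M i e = 0)
    (e : Abelian.Ext.{u} (ModuleCat.of A (A ⧸ (J ⊔ K))) M (i + 1))
    (heJ : res le_sup_left M (i + 1) e = 0) (heK : res le_sup_right M (i + 1) e = 0) :
    res (sup_le_sup hJ hK) M (i + 1) e = 0 :=
  pullback_τ₃_eq_zero (mayerVietoris_shortExact J' K') (mayerVietoris_shortExact J K)
    (mayerVietorisMap hJ hK) h e (pullback_mayerVietoris_g_eq_zero e heJ heK)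

/-- A class on `A ⧸ J` vanishing on `A ⧸ (J ⊓ K)` extends to `A ⧸ (J ⊔ K)`. -/
lemma exists_res_sup_eq (e : Abelian.Ext.{u} (ModuleCat.of A (A ⧸ J)) M i)
    (he : res (inf_le_left : J ⊓ K ≤ J) M i e = 0) :
    ∃ c : Abelian.Ext.{u} (ModuleCat.of A (A ⧸ (J ⊔ K))) M i, res le_sup_left M i c = e := by
  obtain ⟨c, hc⟩ := Abelian.Ext.contravariant_sequence_exact₂ (mayerVietoris_shortExact J K) M
    (pullback (ModuleCat.ofHom (LinearMap.fst A (A ⧸ J) (A ⧸ K))) M i e)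
    ((pullback_pullback (mayerVietoris J K).f _ e).trans he)
  refine ⟨c, ?_⟩
  have hc' := congrArg (pullback (ModuleCat.ofHom (LinearMap.inl A (A ⧸ J) (A ⧸ K))) M i) hc
  rw [pullback_pullback] at hc'
  have h₁ : ModuleCat.ofHom (LinearMap.inl A (A ⧸ J) (A ⧸ K)) ≫
      ModuleCat.ofHom (LinearMap.fst A (A ⧸ J) (A ⧸ K)) = 𝟙 _ := by
    ext
    rfl
  have h₂ : ModuleCat.ofHom (LinearMap.inl A (A ⧸ J) (A ⧸ K)) ≫ (mayerVietoris J K).g =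
      quot le_sup_left := by
    ext
    simp [mayerVietoris, quot]
  rw [h₁, pullback_id] at hc'
  refine Eq.trans ?_ hc'
  exact (congrArg (fun f ↦ pullback f M i c) h₂).symm.trans (pullback_pullback _ _ c).symm

end MayerVietoris

lemma le_radical_pow (I : Ideal A) (t : ℕ) : I ≤ (I ^ t).radical :=
  fun _ hx ↦ ⟨t, Ideal.pow_mem_pow hx t⟩

/-- The pro-system of the modules `A ⧸ L`, where `L` runs over the ideals with `J ≤ √L`, has
vanishing `Ext` groups in all degrees above `n`. -/
def ProVanish (J : Ideal A) (n : ℕ) : Prop :=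
  ∀ L : Ideal A, J ≤ L.radical → ∃ (L' : Ideal A) (h : L' ≤ L), J ≤ L'.radical ∧
    ∀ (M : ModuleCat.{u} A) (i : ℕ), n < i →
      ∀ e : Abelian.Ext.{u} (ModuleCat.of A (A ⧸ L)) M i, res h M i e = 0

lemma ProVanish.of_radical_eq {J K : Ideal A} {n : ℕ} (h : ProVanish J n)
    (hJK : J.radical = K.radical) : ProVanish K n := by
  intro L hL
  rw [← Ideal.radical_le_radical_iff, ← hJK, Ideal.radical_le_radical_iff] at hL
  obtain ⟨L', hL', hJ, h⟩ := h L hL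
  rw [← Ideal.radical_le_radical_iff, hJK, Ideal.radical_le_radical_iff] at hJ
  exact ⟨L', hL', hJ, h⟩

instance : Projective (ModuleCat.of A A) :=
  (IsProjective.iff_projective A).1 inferInstance

lemma proVanish_bot : ProVanish (⊥ : Ideal A) 0 := by
  intro L _
  refine ⟨⊥, bot_le, bot_le, fun M i hi e ↦ ?_⟩
  have : Module.Projective A (A ⧸ (⊥ : Ideal A)) :=
    Module.Projective.of_equiv (Submodule.quotEquivOfEqBot ⊥ rfl).symm
  have : Projective (ModuleCat.of A (A ⧸ (⊥ : Ideal A))) :=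
    (IsProjective.iff_projective _).1 this
  obtain ⟨i, rfl⟩ := Nat.exists_eq_succ_of_ne_zero hi.ne'
  exact (res bot_le M _ e).eq_zero_of_projective

/-- If `a b r = 0` implies `b r = 0`, then the inclusion of `(a b)` into `(a)` factors
through `A`. -/
lemma exists_factor_span_singleton (a b : A) (hab : ∀ r, a * b * r = 0 → b * r = 0)
    (h : Ideal.span {a * b} ≤ Ideal.span {a}) :
    ∃ (f : Ideal.span {a * b} →ₗ[A] A) (g : A →ₗ[A] Ideal.span {a}),
      g ∘ₗ f = Submodule.inclusion h := by
  have hex : ∀ z : Ideal.span {a * b}, ∃ r, (z : A) = a * b * r := fun z ↦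
    Ideal.mem_span_singleton.1 z.2
  choose c hc using hex
  have key : ∀ r s, a * b * r = a * b * s → b * r = b * s := fun r s hrs ↦ by
    have := hab (r - s) (by linear_combination hrs)
    linear_combination this
  refine ⟨
    { toFun := fun z ↦ b * c z
      map_add' := fun z w ↦ ?_
      map_smul' := fun r z ↦ ?_ },
    LinearMap.toSpanSingleton A _ ⟨a, Ideal.mem_span_singleton_self a⟩, ?_⟩
  · rw [← mul_add]
    apply key
    rw [mul_add, ← hc, ← hc, ← hc]
    rfl
  · have := key (c (r • z)) (r * c z) (by
      rw [← hc, show a * b * (r * c z) = r * (a * b * c z) by ring, ← hc]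
      rfl)
    rw [this, RingHom.id_apply, smul_eq_mul]
    ring
  · ext z
    change b * c z * a = z
    rw [hc z]
    ring

lemma sup_le_radical_sup {J X J₁ X₁ : Ideal A} (hJ : J ≤ J₁.radical) (hX : X ≤ X₁.radical) :
    J ⊔ X ≤ (J₁ ⊔ X₁).radical :=
  sup_le (hJ.trans (Ideal.radical_mono le_sup_left)) (hX.trans (Ideal.radical_mono le_sup_right))

lemma ProVanish.mono {J : Ideal A} {m n : ℕ} (h : ProVanish J m) (hmn : m ≤ n) :
    ProVanish J n := fun L hL ↦
  have ⟨L', hL', hr, h0⟩ := h L hL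
  ⟨L', hL', hr, fun M i hi ↦ h0 M i (by lia)⟩

section Noetherian

variable [IsNoetherianRing A]

lemma exists_pow_mul_eq_zero (y : A) :
    ∃ k, ∀ t r, y ^ t * y ^ k * r = 0 → y ^ k * r = 0 := by
  obtain ⟨k, hk⟩ := monotone_stabilizes_iff_noetherian.2 (inferInstanceAs (IsNoetherian A A))
    ⟨fun k ↦ LinearMap.ker (LinearMap.mulLeft A (y ^ k)), monotone_nat_of_le_succ fun k r hr ↦ by
      rw [LinearMap.mem_ker, LinearMap.mulLeft_apply] at hr ⊢
      rw [pow_succ', mul_assoc, hr, mul_zero]⟩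
  refine ⟨k, fun t r h ↦ ?_⟩
  have h' : r ∈ LinearMap.ker (LinearMap.mulLeft A (y ^ (k + t))) := by
    rw [LinearMap.mem_ker, LinearMap.mulLeft_apply, ← h]
    ring
  exact (hk (k + t) le_self_add).ge h'

lemma proVanish_span_singleton (y : A) : ProVanish (Ideal.span {y}) 1 := by
  intro L hL
  obtain ⟨t, ht⟩ := (Ideal.span_singleton_le_iff_mem _).1 hL
  obtain ⟨k, hk⟩ := exists_pow_mul_eq_zero y
  have h₁ : Ideal.span {y ^ t * y ^ k} ≤ Ideal.span {y ^ t} :=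
    Ideal.span_singleton_le_span_singleton.2 (dvd_mul_right _ _)
  have h₂ : Ideal.span {y ^ t} ≤ L := (Ideal.span_singleton_le_iff_mem _).2 ht
  refine ⟨_, h₁.trans h₂, (Ideal.span_singleton_le_iff_mem _).2 ⟨t + k, ?_⟩, fun M i hi e ↦ ?_⟩
  · rw [pow_add]
    exact Ideal.mem_span_singleton_self _
  · obtain ⟨i, rfl⟩ := Nat.exists_eq_add_of_lt hi
    obtain ⟨f, g, hfg⟩ := exists_factor_span_singleton (y ^ t) (y ^ k) (hk t) h₁
    rw [← res_res h₁ h₂]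
    refine pullback_τ₃_eq_zero (idealShortComplex_shortExact _) (idealShortComplex_shortExact _)
      (idealShortComplexMap h₁) (fun e ↦ ?_) _ (Abelian.Ext.eq_zero_of_projective _)
    have : (idealShortComplexMap h₁).τ₁ = ModuleCat.ofHom f ≫ ModuleCat.ofHom g := by
      rw [← ModuleCat.ofHom_comp, hfg]
      rfl
    rw [this]
    obtain ⟨j, hj⟩ : ∃ j, 1 + i = j + 1 := ⟨i, add_comm 1 i⟩
    revert e
    rw [hj]
    exact pullback_eq_zero_of_projective _ _

/-- A weak form of the Artin–Rees lemma. -/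
lemma exists_pow_inf_pow_le {J X K : Ideal A} (h : J ⊓ X ≤ K.radical) :
    ∃ p, J ^ p ⊓ X ^ p ≤ K := by
  obtain ⟨q, hq⟩ := Ideal.exists_pow_le_of_le_radical_of_fg h (IsNoetherian.noetherian _)
  obtain ⟨k, hk⟩ := J.exists_pow_inf_eq_pow_smul (M := A) (X ^ q)
  refine ⟨k + q, le_trans ?_ hq⟩
  calc J ^ (k + q) ⊓ X ^ (k + q) ≤ J ^ (k + q) • (⊤ : Ideal A) ⊓ X ^ q := by
        rw [smul_eq_mul, Ideal.mul_top]
        exact inf_le_inf_left _ (Ideal.pow_le_pow_right (by lia))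
    _ ≤ J ^ q * X ^ q := by
        rw [hk _ (by lia), Nat.add_sub_cancel_left, smul_eq_mul]
        exact Ideal.mul_mono_right inf_le_right
    _ ≤ (J ⊓ X) ^ q := by
        rw [← mul_pow]
        exact Ideal.pow_right_mono Ideal.mul_le_inf q

lemma exists_inf_le {J X J₁ X₁ K : Ideal A} (hJ : J ≤ J₁.radical) (hX : X ≤ X₁.radical)
    (hK : J ⊓ X ≤ K.radical) :
    ∃ J₂ ≤ J₁, ∃ X₂ ≤ X₁, J ≤ J₂.radical ∧ X ≤ X₂.radical ∧ J₂ ⊓ X₂ ≤ K := by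
  obtain ⟨p, hp⟩ := exists_pow_inf_pow_le hK
  refine ⟨J₁ ⊓ J ^ p, inf_le_left, X₁ ⊓ X ^ p, inf_le_left, ?_, ?_,
    (inf_le_inf inf_le_right inf_le_right).trans hp⟩
  · rw [Ideal.radical_inf]
    exact le_inf hJ (le_radical_pow J p)
  · rw [Ideal.radical_inf]
    exact le_inf hX (le_radical_pow X p)

/-- Pro-version of injectivity in the Mayer–Vietoris sequence. -/
lemma ProVanish.exists_res_eq_zero {J X : Ideal A} {n : ℕ} (hJX : ProVanish (J ⊓ X) n)
    {L J₁ X₁ : Ideal A} (hJL : J₁ ≤ L) (hXL : X₁ ≤ L) (hJ : J ≤ J₁.radical)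
    (hX : X ≤ X₁.radical) :
    ∃ (L' : Ideal A) (h : L' ≤ L), J ⊔ X ≤ L'.radical ∧
      ∀ (M : ModuleCat.{u} A) (i : ℕ), n + 1 < i →
        ∀ e : Abelian.Ext.{u} (ModuleCat.of A (A ⧸ L)) M i,
          res hJL M i e = 0 → res hXL M i e = 0 → res h M i e = 0 := by
  obtain ⟨K, hK, hKr, hK0⟩ := hJX (J₁ ⊓ X₁) (by
    rw [Ideal.radical_inf]
    exact inf_le_inf hJ hX)
  obtain ⟨J₂, hJ₂, X₂, hX₂, hJr, hXr, hle⟩ := exists_inf_le hJ hX hKr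
  refine ⟨J₂ ⊔ X₂, (sup_le_sup hJ₂ hX₂).trans (sup_le hJL hXL), sup_le_radical_sup hJr hXr,
    fun M i hi e heJ heX ↦ ?_⟩
  obtain ⟨i, rfl⟩ := Nat.exists_eq_succ_of_ne_zero (by lia : i ≠ 0)
  rw [← res_res (sup_le_sup hJ₂ hX₂) (sup_le hJL hXL)]
  refine res_sup_eq_zero hJ₂ hX₂ (fun c ↦ ?_) _ ?_ ?_
  · rw [← res_res hle hK, hK0 M i (by lia), map_zero]
  · rw [res_res, heJ]
  · rw [res_res, heX]

/-- Pro-version of surjectivity in the Mayer–Vietoris sequence. -/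
lemma ProVanish.exists_res_eq {J X : Ideal A} {n : ℕ} (hJX : ProVanish (J ⊓ X) n)
    {J₁ : Ideal A} (hJ : J ≤ J₁.radical) :
    ∃ (L J₂ : Ideal A) (h₁ : J₂ ≤ J₁) (h₂ : J₂ ≤ L), J ≤ J₂.radical ∧ J ⊔ X ≤ L.radical ∧
      ∀ (M : ModuleCat.{u} A) (i : ℕ), n < i →
        ∀ e : Abelian.Ext.{u} (ModuleCat.of A (A ⧸ J₁)) M i,
          ∃ c : Abelian.Ext.{u} (ModuleCat.of A (A ⧸ L)) M i, res h₂ M i c = res h₁ M i e := by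
  obtain ⟨K, hK, hKr, hK0⟩ := hJX J₁ (inf_le_left.trans hJ)
  obtain ⟨J₂, hJ₂, X₂, -, hJr, hXr, hle⟩ := exists_inf_le hJ Ideal.le_radical hKr
  refine ⟨J₂ ⊔ X₂, J₂, hJ₂, le_sup_left, hJr, sup_le_radical_sup hJr hXr, fun M i hi e ↦
    exists_res_sup_eq _ ?_⟩
  rw [res_res, ← res_res hle hK, hK0 M i hi, map_zero]

lemma ProVanish.sup {J X : Ideal A} {n : ℕ} (hJ : ProVanish J (n + 1)) (hX : ProVanish X (n + 1))
    (hJX : ProVanish (J ⊓ X) n) : ProVanish (J ⊔ X) (n + 1) := by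
  intro L hL
  obtain ⟨J₁, hJ₁, hJr, hJ0⟩ := hJ L (le_sup_left.trans hL)
  obtain ⟨X₁, hX₁, hXr, hX0⟩ := hX L (le_sup_right.trans hL)
  obtain ⟨L', h, hr, h0⟩ := hJX.exists_res_eq_zero hJ₁ hX₁ hJr hXr
  exact ⟨L', h, hr, fun M i hi e ↦ h0 M i hi e (hJ0 M i hi e) (hX0 M i hi e)⟩

/-- Local cohomology at an ideal generated by `n` elements vanishes in degrees above `n`. -/
lemma proVanish_span_range {n : ℕ} (x : Fin n → A) : ProVanish (Ideal.span (Set.range x)) n := by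
  induction n with
  | zero =>
    rw [Set.range_eq_empty, Ideal.span_empty]
    exact proVanish_bot
  | succ n ih =>
    have hx : Ideal.span (Set.range x) =
        Ideal.span (Set.range (Fin.tail x)) ⊔ Ideal.span {x 0} := by
      rw [← Ideal.span_union, ← Fin.cons_self_tail x, Fin.range_cons, Fin.tail_cons,
        Set.union_singleton, Fin.cons_zero]
    rw [hx]
    refine ((ih _).mono n.le_succ).sup ((proVanish_span_singleton _).mono (by lia)) ?_
    refine (ih fun j ↦ x 0 * Fin.tail x j).of_radical_eq ?_
    rw [Ideal.radical_inf, ← Ideal.radical_mul, Ideal.span_mul_span', Set.mul_singleton,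
      ← Set.range_comp]
    simp only [Function.comp_def, mul_comm]

end Noetherian

section Comparison

open Opposite

lemma exists_addEquiv_of_ker_eq {Z H E : Type*} [AddCommGroup Z] [AddCommGroup H]
    [AddCommGroup E] (p : Z →+ H) (q : Z →+ E) (hp : Function.Surjective p)
    (hq : Function.Surjective q) (h : p.ker = q.ker) : ∃ e : H ≃+ E, ∀ z, e (p z) = q z := by
  refine ⟨(QuotientAddGroup.quotientKerEquivOfSurjective p hp).symm.trans
    ((QuotientAddGroup.quotientAddEquivOfEq h).trans
      (QuotientAddGroup.quotientKerEquivOfSurjective q hq)), fun z ↦ ?_⟩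
  have : (QuotientAddGroup.quotientKerEquivOfSurjective p hp).symm (p z) =
      (z : Z ⧸ p.ker) := by
    rw [AddEquiv.symm_apply_eq]
    rfl
  rw [AddEquiv.trans_apply, this]
  rfl

variable {R : Type*} [CommRing R] {C : Type*} [Category C] [Abelian C] [Linear R C]

section

variable (R) {X : C} (P : ProjectiveResolution X) (M : C) (n : ℕ)

/-- The complex of morphisms from a projective resolution to `M`, in the opposite category. -/
noncomputable abbrev homComplex : ChainComplex (ModuleCat R)ᵒᵖ ℕ :=
  (((linearYoneda R C).obj M).rightOp.mapHomologicalComplex _).obj P.complex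

/-- The module of `n`-cocycles of the complex of morphisms from a projective resolution to `M`. -/
noncomputable abbrev cocycles : ModuleCat R := unop ((homComplex R P M).opcycles n)

/-- A cocycle, seen as a morphism. -/
noncomputable def cocycleHom : cocycles R P M n →+ (P.complex.X n ⟶ M) :=
  ((homComplex R P M).pOpcycles n).unop.hom.toAddMonoidHom

lemma cocycleHom_injective : Function.Injective (cocycleHom R P M n) :=
  (ModuleCat.mono_iff_injective ((homComplex R P M).pOpcycles n).unop).1 inferInstance

lemma d_comp_cocycleHom (m : ℕ) (z : cocycles R P M n) :
    P.complex.d m n ≫ cocycleHom R P M n z = 0 :=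
  ConcreteCategory.congr_hom
    (congrArg Quiver.Hom.unop ((homComplex R P M).d_pOpcycles m n)) z

lemma exists_cocycleHom_eq (f : P.complex.X n ⟶ M) (hf : P.complex.d (n + 1) n ≫ f = 0) :
    ∃ z, cocycleHom R P M n z = f := by
  have h : (ShortComplex.mk _ _ ((homComplex R P M).d_pOpcycles (n + 1) n)).Exact :=
    ShortComplex.exact_of_g_is_cokernel _
      ((homComplex R P M).opcyclesIsCokernel (n + 1) n (by simp))
  exact (ShortComplex.moduleCat_exact_iff _).1 h.unop f hf

variable [HasExt.{u} C]

/-- The class of a cocycle in the `Ext` group defined through the derived category. -/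
noncomputable def cocycleExt : cocycles R P M n →+ Abelian.Ext.{u} X M n where
  toFun z := P.extMk (cocycleHom R P M n z) (n + 1) rfl (d_comp_cocycleHom R P M n (n + 1) z)
  map_zero' := by
    simp only [map_zero]
    exact P.extMk_zero _ _
  map_add' z w := by
    simp only [map_add]
    exact (P.add_extMk _ _ _ _ _ _).symm

lemma cocycleExt_surjective : Function.Surjective (cocycleExt R P M n) := by
  intro e
  obtain ⟨f, hf, rfl⟩ := P.extMk_surjective e (n + 1) rfl
  obtain ⟨z, rfl⟩ := exists_cocycleHom_eq R P M n f hf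
  exact ⟨z, rfl⟩

lemma cocycleExt_eq_zero_iff (z : cocycles R P M (n + 1)) :
    cocycleExt R P M (n + 1) z = 0 ↔
      ∃ g : P.complex.X n ⟶ M, P.complex.d (n + 1) n ≫ g = cocycleHom R P M (n + 1) z :=
  P.extMk_eq_zero_iff (cocycleHom R P M (n + 1) z) (n + 1 + 1) rfl
    (d_comp_cocycleHom R P M (n + 1) (n + 1 + 1) z) n rfl


end

section

variable [EnoughProjectives C] (R) {X : C} (P : ProjectiveResolution X) (M : C) (n : ℕ)

/-- The derived functor `Ext` is computed by a projective resolution. -/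
noncomputable def extIso :
    (((linearYoneda R C).obj M).rightOp.leftDerived n).obj X ≅ (homComplex R P M).homology n :=
  P.isoLeftDerivedObj ((linearYoneda R C).obj M).rightOp n

/-- The class of a cocycle in the derived functor `Ext`. -/
noncomputable def cocycleClass :
    cocycles R P M n ⟶ ((_root_.Ext R C n).obj (op X)).obj M :=
  ((extIso R P M n).hom ≫ (homComplex R P M).homologyι n).unop

lemma cocycleClass_surjective : Function.Surjective (cocycleClass R P M n) :=
  (ModuleCat.epi_iff_surjective
    ((extIso R P M n).hom ≫ (homComplex R P M).homologyι n).unop).1 inferInstance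

lemma cocycleClass_eq_zero_iff (z : cocycles R P M (n + 1)) :
    cocycleClass R P M (n + 1) z = 0 ↔
      ∃ g : P.complex.X n ⟶ M, P.complex.d (n + 1) n ≫ g = cocycleHom R P M (n + 1) z := by
  have h : (ShortComplex.mk _ _
      ((homComplex R P M).homologyι_comp_fromOpcycles (n + 1) n)).Exact :=
    ShortComplex.exact_of_f_is_kernel _ ((homComplex R P M).homologyIsKernel (n + 1) n (by simp))
  have h' := (ShortComplex.moduleCat_exact_iff _).1 h.unop z
  have hz : cocycleClass R P M (n + 1) z = 0 ↔
      ((homComplex R P M).homologyι (n + 1)).unop z = 0 := by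
    have hi : Function.Injective (extIso R P M (n + 1)).hom.unop :=
      (ModuleCat.mono_iff_injective _).1 inferInstance
    exact map_eq_zero_iff (ConcreteCategory.hom (extIso R P M (n + 1)).hom.unop) hi
  have hd : ∀ g : P.complex.X n ⟶ M, cocycleHom R P M (n + 1)
      (((homComplex R P M).fromOpcycles (n + 1) n).unop g) = P.complex.d (n + 1) n ≫ g := fun g ↦
    ConcreteCategory.congr_hom
      (congrArg Quiver.Hom.unop ((homComplex R P M).p_fromOpcycles (n + 1) n)) g
  rw [hz]
  constructor
  · intro h0
    obtain ⟨g, hg⟩ := h' h0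
    exact ⟨g, (hd g).symm.trans (congrArg _ hg)⟩
  · rintro ⟨g, hg⟩
    rw [← hd] at hg
    rw [← cocycleHom_injective R P M (n + 1) hg]
    exact ConcreteCategory.congr_hom
      (congrArg Quiver.Hom.unop ((homComplex R P M).homologyι_comp_fromOpcycles (n + 1) n)) g

variable {P M n} in
lemma map_cocycleClass {X' : C} {P' : ProjectiveResolution X'} {f : X' ⟶ X}
    (φ : ProjectiveResolution.Hom P' P f) (z : cocycles R P M n) :
    ∃ z' : cocycles R P' M n, cocycleHom R P' M n z' = φ.hom.f n ≫ cocycleHom R P M n z ∧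
      ((_root_.Ext R C n).map f.op).app M (cocycleClass R P M n z) = cocycleClass R P' M n z' := by
  let Φ := (((linearYoneda R C).obj M).rightOp.mapHomologicalComplex
    (ComplexShape.down ℕ)).map φ.hom
  refine ⟨(HomologicalComplex.opcyclesMap Φ n).unop z, ?_, ?_⟩
  · exact ConcreteCategory.congr_hom
      (congrArg Quiver.Hom.unop (HomologicalComplex.p_opcyclesMap Φ n)) z
  · have h : (((linearYoneda R C).obj M).rightOp.leftDerived n).map f ≫
        (extIso R P M n).hom ≫ (homComplex R P M).homologyι n =
        ((extIso R P' M n).hom ≫ (homComplex R P' M).homologyι n) ≫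
          HomologicalComplex.opcyclesMap Φ n := by
      have h₁ : (((linearYoneda R C).obj M).rightOp.leftDerived n).map f ≫
          (extIso R P M n).hom = (extIso R P' M n).hom ≫ HomologicalComplex.homologyMap Φ n :=
        ProjectiveResolution.isoLeftDerivedObj_hom_naturality f P' P φ.hom
          (φ.hom_f_zero_comp_π_f_zero.trans
            (congrArg (P'.π.f 0 ≫ ·) (ChainComplex.single₀_map_f_zero f))) _ n
      rw [← Category.assoc, h₁, Category.assoc, Category.assoc,
        HomologicalComplex.homologyι_naturality]
    exact ConcreteCategory.congr_hom (congrArg Quiver.Hom.unop h) z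

variable [HasExt.{u} C] (C) in
/-- In positive degrees, the `Ext` modules defined as derived functors are naturally isomorphic to
the `Ext` groups defined through the derived category. -/
theorem exists_extEquiv :
    ∃ e : ∀ X : C, ((_root_.Ext R C (n + 1)).obj (op X)).obj M ≃+ Abelian.Ext.{u} X M (n + 1),
      ∀ (X X' : C) (f : X' ⟶ X) (a : ((_root_.Ext R C (n + 1)).obj (op X)).obj M),
        e X' (((_root_.Ext R C (n + 1)).map f.op).app M a) = pullback f M (n + 1) (e X a) := by
  have h (X : C) := exists_addEquiv_of_ker_eq
    (cocycleClass R (projectiveResolution X) M (n + 1)).hom.toAddMonoidHom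
    (cocycleExt R (projectiveResolution X) M (n + 1))
    (cocycleClass_surjective R _ M (n + 1)) (cocycleExt_surjective R _ M (n + 1)) (by
      ext z
      exact (cocycleClass_eq_zero_iff R _ M n z).trans (cocycleExt_eq_zero_iff R _ M n z).symm)
  choose e he using h
  refine ⟨e, fun X X' f a ↦ ?_⟩
  obtain ⟨z, rfl⟩ := cocycleClass_surjective R (projectiveResolution X) M (n + 1) a
  let φ : ProjectiveResolution.Hom (projectiveResolution X') (projectiveResolution X) f :=
    ⟨ProjectiveResolution.lift f _ _, (ProjectiveResolution.lift_commutes_zero f _ _).trans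
      (congrArg (_ ≫ ·) (ChainComplex.single₀_map_f_zero f).symm)⟩
  obtain ⟨z', hz', h⟩ := map_cocycleClass R φ z
  rw [h]
  refine (he X' z').trans (Eq.trans ?_ (congrArg (pullback f M (n + 1)) (he X z)).symm)
  refine Eq.trans ?_ (ProjectiveResolution.mk₀_comp_extMk
    (cocycleHom R (projectiveResolution X) M (n + 1) z) (n + 1 + 1) rfl
    (d_comp_cocycleHom R _ M (n + 1) (n + 1 + 1) z) φ).symm
  have key : ∀ (g) (hg), cocycleHom R (projectiveResolution X') M (n + 1) z' = g →
      cocycleExt R (projectiveResolution X') M (n + 1) z' =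
        (projectiveResolution X').extMk g (n + 1 + 1) rfl hg := by
    rintro _ _ rfl
    rfl
  exact key _ _ hz'

end

end Comparison

section Colimits

open Limits

lemma isIso_colimMap {A : Type u} [CommRing A] {D : Type} [SmallCategory D] [IsFiltered D]
    {F G : D ⥤ ModuleCat.{u} A} (α : F ⟶ G)
    (hinj : ∀ (j : D) (a : F.obj j), α.app j a = 0 → ∃ (k : D) (f : j ⟶ k), F.map f a = 0)
    (hsurj : ∀ (j : D) (b : G.obj j), ∃ (k : D) (f : j ⟶ k) (a : F.obj k),
      α.app k a = G.map f b) :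
    IsIso (colimMap α) := by
  have := preservesSmallestFilteredColimits_of_preservesFilteredColimits
    (forget (ModuleCat.{u} A))
  have hι (j : D) (a : F.obj j) :
      colimMap α (colimit.ι F j a) = colimit.ι G j (α.app j a) :=
    ConcreteCategory.congr_hom (ι_colimMap α j) a
  have hw {H : D ⥤ ModuleCat.{u} A} {j k : D} (f : j ⟶ k) (a : H.obj j) :
      colimit.ι H k (H.map f a) = colimit.ι H j a :=
    ConcreteCategory.congr_hom (colimit.w H f) a
  rw [ConcreteCategory.isIso_iff_bijective]
  refine ⟨(injective_iff_map_eq_zero (colimMap α).hom).2 fun c hc ↦ ?_, fun c ↦ ?_⟩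
  · obtain ⟨j, a, rfl⟩ := Concrete.isColimit_exists_rep F (colimit.isColimit F) c
    obtain ⟨k, f, g, h⟩ := Concrete.isColimit_exists_of_rep_eq G (colimit.isColimit G)
      (α.app j a) (0 : G.obj j) (((hι j a).symm.trans hc).trans (map_zero (colimit.ι G j).hom).symm)
    rw [map_zero] at h
    obtain ⟨l, f', h'⟩ := hinj k (F.map f a)
      ((ConcreteCategory.congr_hom (α.naturality f) a).trans h)
    refine (hw f a).symm.trans ((hw f' _).symm.trans ?_)
    rw [h', map_zero]
  · obtain ⟨j, b, rfl⟩ := Concrete.isColimit_exists_rep G (colimit.isColimit G) c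
    obtain ⟨k, f, a, h⟩ := hsurj j b
    refine ⟨colimit.ι F k a, (hι k a).trans ?_⟩
    rw [h]
    exact hw f b

end Colimits

section LocalCohomology

open Opposite Limits localCohomology

variable {J K : Ideal A}

/-- The map of diagrams computing local cohomology induced by an inclusion of ideals. -/
noncomputable def diagramMap (h : J ≤ K) (i : ℕ) :
    diagram (idealPowersDiagram K) i ⟶ diagram (idealPowersDiagram J) i :=
  Functor.whiskerRight (NatTrans.op (F := ringModIdeals (idealPowersDiagram J))
    (G := ringModIdeals (idealPowersDiagram K))
    { app _ := quot (Ideal.pow_right_mono h _)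
      naturality s _ f :=
        (quot_comp (Ideal.pow_le_pow_right f.unop.down.down) _).trans
          (quot_comp (Ideal.pow_right_mono h (unop s)) _).symm })
    (_root_.Ext A (ModuleCat.{u} A) i)

/-- Suppose that the comparison map from the pro-system of the powers of `J` to the pro-system of
the powers of `K` induces a bijection on `Ext`. Then local cohomology at `J` and `K` agree. -/
theorem nonempty_localCohomology_equiv (h : J ≤ K) (M : ModuleCat.{u} A) (i : ℕ)
    (hinj : ∀ (t : ℕ) (e : Abelian.Ext.{u} (ModuleCat.of A (A ⧸ K ^ t)) M (i + 1)),
      res (Ideal.pow_right_mono h t) M (i + 1) e = 0 →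
        ∃ (s : ℕ) (hs : t ≤ s), res (Ideal.pow_le_pow_right hs) M (i + 1) e = 0)
    (hsurj : ∀ (t : ℕ) (e : Abelian.Ext.{u} (ModuleCat.of A (A ⧸ J ^ t)) M (i + 1)),
      ∃ (s : ℕ) (hs : t ≤ s) (c : Abelian.Ext.{u} (ModuleCat.of A (A ⧸ K ^ s)) M (i + 1)),
        res (Ideal.pow_right_mono h s) M (i + 1) c =
          res (Ideal.pow_le_pow_right hs) M (i + 1) e) :
    Nonempty ((localCohomology K (i + 1)).obj M ≃ₗ[A] (localCohomology J (i + 1)).obj M) := by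
  obtain ⟨e, he⟩ := exists_extEquiv A (ModuleCat.{u} A) M i
  have : IsIso (colimMap
      (Functor.whiskerRight (diagramMap h (i + 1)) ((evaluation _ _).obj M))) := by
    refine isIso_colimMap _ ?_ ?_
    · rintro ⟨⟨t⟩⟩ a ha
      obtain ⟨s, hs, h0⟩ := hinj t (e _ a)
        ((he _ _ _ a).symm.trans ((congrArg (e _) ha).trans (map_zero _)))
      refine ⟨op (op s), (homOfLE hs).op.op, (e _).injective ?_⟩
      exact (he _ _ _ a).trans (h0.trans (map_zero _).symm)
    · rintro ⟨⟨t⟩⟩ b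
      obtain ⟨s, hs, c, hc⟩ := hsurj t (e _ b)
      refine ⟨op (op s), (homOfLE hs).op.op, (e _).symm c, (e _).injective ?_⟩
      refine (he _ _ _ _).trans (Eq.trans ?_ (he _ _ _ b).symm)
      exact (congrArg (res (Ideal.pow_right_mono h s) M (i + 1))
        ((e _).apply_symm_apply c)).trans hc
  exact ⟨((colimitObjIsoColimitCompEvaluation (diagram (idealPowersDiagram K) (i + 1)) M) ≪≫
    asIso (colimMap (Functor.whiskerRight (diagramMap h (i + 1)) ((evaluation _ _).obj M))) ≪≫
      (colimitObjIsoColimitCompEvaluation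
        (diagram (idealPowersDiagram J) (i + 1)) M).symm).toLinearEquiv⟩

/-- Suppose that local cohomology at `J ⊓ X` and `X` vanishes in degrees above `n`. Then local
cohomology at `J ⊔ X` and at `J` agree in degrees above `n + 1`. -/
theorem ProVanish.nonempty_localCohomology_sup_equiv [IsNoetherianRing A] {J X : Ideal A} {n : ℕ}
    (hJX : ProVanish (J ⊓ X) n) (hX : ProVanish X n) (M : ModuleCat.{u} A) {i : ℕ}
    (hi : n + 1 < i) :
    Nonempty ((localCohomology (J ⊔ X) i).obj M ≃ₗ[A] (localCohomology J i).obj M) := by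
  obtain ⟨i, rfl⟩ := Nat.exists_eq_succ_of_ne_zero (by lia : i ≠ 0)
  have hpow {I L : Ideal A} (h : I ≤ L.radical) (t : ℕ) : ∃ s, t ≤ s ∧ I ^ s ≤ L := by
    obtain ⟨s, hs⟩ := Ideal.exists_pow_le_of_le_radical_of_fg h (IsNoetherian.noetherian I)
    exact ⟨max s t, le_max_right _ _, (Ideal.pow_le_pow_right (le_max_left _ _)).trans hs⟩
  refine nonempty_localCohomology_equiv le_sup_left M i (fun t e he ↦ ?_) (fun t e ↦ ?_)
  · obtain ⟨X₁, hX₁, hXr, h0⟩ := hX ((J ⊔ X) ^ t) (le_sup_right.trans (le_radical_pow _ t))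
    obtain ⟨L, hL, hLr, hL0⟩ := hJX.exists_res_eq_zero
      (Ideal.pow_right_mono (le_sup_left : J ≤ J ⊔ X) t) hX₁ (le_radical_pow J t) hXr
    obtain ⟨s, hts, hs⟩ := hpow hLr t
    refine ⟨s, hts, ?_⟩
    rw [← res_res hs hL, hL0 M _ hi e he (h0 M _ (by lia) e), map_zero]
  · obtain ⟨L, J₂, h₁, h₂, hJr, hLr, hc⟩ := hJX.exists_res_eq (le_radical_pow J t)
    obtain ⟨c, hc⟩ := hc M (i + 1) (by lia) e
    obtain ⟨s₁, hts₁, hs₁⟩ := hpow hLr t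
    obtain ⟨s, hts, hs⟩ := hpow hJr s₁
    have hL : (J ⊔ X) ^ s ≤ L := (Ideal.pow_le_pow_right hts).trans hs₁
    refine ⟨s, hts₁.trans hts, res hL M _ c, ?_⟩
    rw [res_res, ← res_res hs h₁, ← hc, res_res]

lemma radical_inf_span_range_eq (I₀ : Ideal A) {n : ℕ} (x : Fin n → A) (y : A)
    (h : Ideal.span (Set.range fun j ↦ y * x j) ≤ I₀) :
    (Ideal.span (Set.range fun j ↦ y * x j)).radical =
      (Ideal.span {y} ⊓ I₀ ⊓ Ideal.span (Set.range x)).radical := by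
  have hmul : Ideal.span (Set.range fun j ↦ y * x j) =
      Ideal.span {y} * Ideal.span (Set.range x) := by
    rw [Ideal.span_mul_span', Set.singleton_mul, ← Set.range_comp]
    rfl
  refine le_antisymm (Ideal.radical_mono (le_inf (le_inf ?_ h) ?_)) ?_
  · exact hmul.trans_le Ideal.mul_le_left
  · exact hmul.trans_le Ideal.mul_le_right
  · rw [hmul, Ideal.radical_mul, ← Ideal.radical_inf]
    exact Ideal.radical_mono (inf_le_inf_right _ inf_le_left)

end LocalCohomology

end ProExt

/-- Let `A` be a Noetherian ring, `I₀` an ideal, and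
`x₁, …, x_{e-1}, x_e ∈ A` (here `e = n + 1`, the `x₁, …, x_{e-1}` are `x : Fin n → A` and
`x_e = xe`) with `(x_e x₁, …, x_e x_{e-1}) ⊆ I₀`.  If `I` is an ideal with
`√I = √(x_e A ∩ I₀ + (x₁, …, x_{e-1})A)`, then `H_I^i(M) ≅ H_{x_e A ∩ I₀}^i(M)` for every
`A`-module `M` and every `i > e`. -/
theorem localCohomology_iso_of_radical_eq
    (A : Type u) [CommRing A] [IsNoetherianRing A]
    (I₀ : Ideal A) (n : ℕ) (x : Fin n → A) (xe : A)
    (hsub : Ideal.span (Set.range fun j => xe * x j) ≤ I₀)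
    (I : Ideal A)
    (hI : I.radical = (Ideal.span {xe} ⊓ I₀ + Ideal.span (Set.range x)).radical)
    (M : ModuleCat.{u} A) (i : ℕ) (hi : n + 1 < i) :
    Nonempty (((localCohomology I i).obj M) ≃ₗ[A]
      ((localCohomology (Ideal.span {xe} ⊓ I₀) i).obj M)) := by
  have hJX : ProExt.ProVanish (Ideal.span {xe} ⊓ I₀ ⊓ Ideal.span (Set.range x)) n :=
    (ProExt.proVanish_span_range _).of_radical_eq
      (ProExt.radical_inf_span_range_eq I₀ x xe hsub)
  obtain ⟨e⟩ := hJX.nonempty_localCohomology_sup_equiv (ProExt.proVanish_span_range x) M hi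
  exact ⟨((localCohomology.isoOfSameRadical hI i).app M).toLinearEquiv.trans e⟩
end
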